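/- Every closed connected complex Lie subgroup F with SL(2,ℂ) ⊆ F ⊆ SL(4,ℂ) (where SL(2,ℂ) is embedded via Sym³ of the standard representation) equals SL(2,ℂ), Sp(4,ℂ), or SL(4,ℂ). -/

import Mathlib

/-- The subspace topology on `SL(n, R)` induced from the space of matrices. -/
instance SLtop (n : Type*) (R : Type*) [DecidableEq n] [Fintype n] [CommRing R]
    [TopologicalSpace R] : TopologicalSpace (Matrix.SpecialLinearGroup n R) :=
  TopologicalSpace.induced ((↑) : Matrix.SpecialLinearGroup n R → Matrix n n R) inferInstance

section

open Filter Topology NormedSpace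

section LieTools

variable {𝔸 : Type*} [NormedRing 𝔸] [NormedAlgebra ℝ 𝔸] [CompleteSpace 𝔸]

lemma exp_add_smul' (X : 𝔸) (s t : ℝ) : exp ((s + t) • X) = exp (s • X) * exp (t • X) := by
  let _ : NormedAlgebra ℚ 𝔸 := NormedAlgebra.restrictScalars ℚ ℝ 𝔸
  rw [add_smul]
  exact exp_add_of_commute ((Commute.refl X).smul_left s |>.smul_right t)

lemma exp_neg_mul (X : 𝔸) : exp (-X) * exp X = 1 := by
  have h := exp_add_smul' X (-1) 1
  simpa using h.symm

lemma exp_mul_neg (X : 𝔸) : exp X * exp (-X) = 1 := by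
  have h := exp_add_smul' X 1 (-1)
  simpa using h.symm

lemma exp_natCast_smul (X : 𝔸) (n : ℕ) : exp ((n : ℝ) • X) = exp X ^ n := by
  induction n with
  | zero => simp
  | succ n ih => rw [pow_succ, ← ih, Nat.cast_succ, exp_add_smul']; simp

lemma hasDerivAt_exp_smul0 (X : 𝔸) : HasDerivAt (fun t : ℝ => exp (t • X)) X 0 := by
  simpa using hasDerivAt_exp_smul_const (𝕂 := ℝ) X 0

lemma continuous_exp' : Continuous (exp : 𝔸 → 𝔸) := by
  let _ : NormedAlgebra ℚ 𝔸 := NormedAlgebra.restrictScalars ℚ ℝ 𝔸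
  exact exp_continuous

lemma pow_tendsto_exp (γ : ℝ → 𝔸) (Z : 𝔸) (h0 : γ 0 = 1) (hγ : HasDerivAt γ Z 0) :
    Tendsto (fun n : ℕ => γ ((n : ℝ)⁻¹) ^ n) atTop (𝓝 (exp Z)) := by
  have hs : HasStrictFDerivAt (exp : 𝔸 → 𝔸)
      ((ContinuousLinearEquiv.refl ℝ 𝔸 : 𝔸 ≃L[ℝ] 𝔸) : 𝔸 →L[ℝ] 𝔸) 0 :=
    hasStrictFDerivAt_exp_zero (𝕂 := ℝ)
  set L := hs.localInverse
  have hL0 : L 1 = 0 := by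
    have := hs.localInverse_apply_image
    simpa using this
  have hLd := hs.to_localInverse
  have hri := hs.eventually_right_inverse
  simp only [exp_zero] at hLd hri
  have hLγ : HasDerivAt (fun t => L (γ t)) Z 0 := by
    have h1 : HasFDerivAt L ((ContinuousLinearEquiv.refl ℝ 𝔸).symm : 𝔸 →L[ℝ] 𝔸) (γ 0) := by
      rw [h0]; exact hLd.hasFDerivAt
    exact h1.comp_hasDerivAt (0 : ℝ) hγ
  have hinv : Tendsto (fun n : ℕ => ((n : ℝ)⁻¹)) atTop (𝓝[≠] 0) := by
    apply tendsto_nhdsWithin_of_tendsto_nhds_of_eventually_within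
    · exact tendsto_inv_atTop_nhds_zero_nat
    · filter_upwards [eventually_gt_atTop 0] with n hn
      simpa using hn.ne'
  have h2 := hLγ.tendsto_slope.comp hinv
  have h3 := (continuous_exp'.tendsto Z).comp h2
  have h4 : ∀ᶠ n : ℕ in atTop, exp (L (γ ((n : ℝ)⁻¹))) = γ ((n : ℝ)⁻¹) := by
    have hc : Tendsto (fun n : ℕ => γ ((n : ℝ)⁻¹)) atTop (𝓝 1) := by
      have := hγ.continuousAt.tendsto
      rw [h0] at this
      exact this.comp tendsto_inv_atTop_nhds_zero_nat
    exact hc.eventually hri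
  refine h3.congr' ?_
  filter_upwards [h4] with n hn
  simp only [Function.comp, slope_def_module, h0, hL0, sub_zero, inv_inv]
  rw [exp_natCast_smul, hn]

lemma hasDerivAt_exp_mul_exp (X Y : 𝔸) (t : ℝ) :
    HasDerivAt (fun s : ℝ => exp (s • t • X) * exp (s • t • Y)) (t • (X + Y)) 0 := by
  exact ((hasDerivAt_exp_smul0 (t • X)).mul (hasDerivAt_exp_smul0 (t • Y))).congr_deriv (by simp)

lemma one_param (γ : ℝ → 𝔸) (hc : Continuous γ) (h0 : γ 0 = 1)
    (hadd : ∀ s t, γ (s + t) = γ s * γ t) : ∃ X : 𝔸, ∀ t : ℝ, γ t = exp (t • X) := by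
  set G : ℝ → 𝔸 := fun t => ∫ s in (0:ℝ)..t, γ s with hG
  have hGd : ∀ t, HasDerivAt G (γ t) t := fun t =>
    intervalIntegral.integral_hasDerivAt_right (hc.intervalIntegrable _ _)
      (hc.stronglyMeasurableAtFilter _ _) hc.continuousAt
  have hsl := (hGd 0).tendsto_slope
  rw [h0] at hsl
  have hG0 : G 0 = 0 := by simp [hG]
  have hu : ∀ᶠ δ in 𝓝[≠] (0:ℝ), IsUnit (slope G 0 δ) :=
    hsl.eventually (Units.isOpen.mem_nhds isUnit_one)
  obtain ⟨δ, hδu, hδ⟩ := (hu.and self_mem_nhdsWithin).exists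
  have hδ : δ ≠ 0 := hδ
  obtain ⟨u, hu⟩ := hδu
  have hGδ : G δ = δ • (u : 𝔸) := by
    rw [hu, slope_def_module, hG0]; simp [smul_smul, hδ]
  have key : ∀ t, γ t * G δ = G (t + δ) - G t := by
    intro t
    have h1 : γ t * G δ = ∫ s in (0:ℝ)..δ, γ (t + s) := by
      simp only [hadd, hG]
      exact ((ContinuousLinearMap.mul ℝ 𝔸 (γ t)).intervalIntegral_comp_comm
        (hc.intervalIntegrable 0 δ)).symm
    rw [h1, intervalIntegral.integral_comp_add_left (fun s => γ s) t, add_zero]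
    rw [eq_sub_iff_add_eq, add_comm]
    exact intervalIntegral.integral_add_adjacent_intervals (hc.intervalIntegrable _ _)
      (hc.intervalIntegrable _ _)
  have hγ : ∀ t, γ t = (G (t + δ) - G t) * (δ⁻¹ • ((u⁻¹ : 𝔸ˣ) : 𝔸)) := by
    intro t
    rw [← key, hGδ, mul_assoc]
    simp [smul_smul, hδ]
  have hd0 : HasDerivAt γ ((γ (0 + δ) - γ 0) * (δ⁻¹ • ((u⁻¹ : 𝔸ˣ) : 𝔸))) 0 := by
    have h1 : HasDerivAt (fun t => G (t + δ)) (γ (0 + δ)) 0 := by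
      have := (hGd (0 + δ)).comp_add_const 0 δ
      exact this
    have := (h1.sub (hGd 0)).mul_const (δ⁻¹ • ((u⁻¹ : 𝔸ˣ) : 𝔸))
    exact this.congr_of_eventuallyEq (Eventually.of_forall hγ)
  set X := (γ (0 + δ) - γ 0) * (δ⁻¹ • ((u⁻¹ : 𝔸ˣ) : 𝔸))
  have hd : ∀ t, HasDerivAt γ (γ t * X) t := by
    intro t
    have h1 : HasDerivAt (fun s => γ (s - t)) X t := by
      have h2 : HasDerivAt γ X (t - t) := by simpa using hd0
      exact h2.comp_sub_const t t
    have h3 := h1.const_mul (γ t)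
    refine h3.congr_of_eventuallyEq (Eventually.of_forall fun s => ?_)
    simp only [← hadd]; congr 1; ring
  refine ⟨X, fun t => ?_⟩
  have hcst : ∀ t, HasDerivAt (fun t => γ t * exp (t • (-X))) 0 t := by
    intro t
    have h := (hd t).mul (hasDerivAt_exp_smul_const' (𝕂 := ℝ) (-X) t)
    exact h.congr_deriv (by noncomm_ring)
  have h1 := is_const_of_deriv_eq_zero (fun t => (hcst t).differentiableAt)
    (fun t => (hcst t).deriv) t 0
  simp [h0] at h1
  calc γ t = γ t * (exp (-(t • X)) * exp (t • X)) := by rw [exp_neg_mul]; simp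
    _ = _ := by rw [← mul_assoc, h1, one_mul]

lemma exp_smul_inj {X Y : 𝔸} (h : ∀ t : ℝ, exp (t • X) = exp (t • Y)) : X = Y := by
  have h1 := hasDerivAt_exp_smul0 X
  rw [show (fun t : ℝ => exp (t • X)) = fun t : ℝ => exp (t • Y) from funext h] at h1
  exact h1.unique (hasDerivAt_exp_smul0 Y)

/-- Lie algebra of a closed submonoid. -/
def lieOf (S : Submonoid 𝔸) (hS : IsClosed (S : Set 𝔸)) : Submodule ℝ 𝔸 where
  carrier := {X | ∀ t : ℝ, exp (t • X) ∈ S}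
  zero_mem' := by intro t; simp
  smul_mem' c X hX := by intro t; rw [smul_smul]; exact hX _
  add_mem' := by
    intro X Y hX hY t
    have h := pow_tendsto_exp _ _ (by simp) (hasDerivAt_exp_mul_exp X Y t)
    refine hS.mem_of_tendsto h (Eventually.of_forall fun n => S.pow_mem (S.mul_mem ?_ ?_) n)
    · rw [smul_smul]; exact hX _
    · rw [smul_smul]; exact hY _

lemma mem_lieOf {S : Submonoid 𝔸} {hS : IsClosed (S : Set 𝔸)} {X : 𝔸} :
    X ∈ lieOf S hS ↔ ∀ t : ℝ, exp (t • X) ∈ S := Iff.rfl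

lemma exp_mem_of_mem_lieOf {S : Submonoid 𝔸} {hS : IsClosed (S : Set 𝔸)} {X : 𝔸}
    (h : X ∈ lieOf S hS) : exp X ∈ S := by simpa using mem_lieOf.1 h 1

lemma exp_conj_of {a b : 𝔸} (hab : a * b = 1) (hba : b * a = 1) (X : 𝔸) :
    exp (a * X * b) = a * exp X * b := by
  let _ : NormedAlgebra ℚ 𝔸 := NormedAlgebra.restrictScalars ℚ ℝ 𝔸
  exact exp_units_conj (⟨a, b, hab, hba⟩ : 𝔸ˣ) X

lemma conj_mem_lieOf {S : Submonoid 𝔸} {hS : IsClosed (S : Set 𝔸)} {X a b : 𝔸}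
    (ha : a ∈ S) (hb : b ∈ S) (hab : a * b = 1) (hba : b * a = 1)
    (h : X ∈ lieOf S hS) : a * X * b ∈ lieOf S hS := by
  intro t
  rw [show t • (a * X * b) = a * (t • X) * b by simp, exp_conj_of hab hba]
  exact S.mul_mem (S.mul_mem ha (h t)) hb

lemma hasDerivAt_conj (X Y : 𝔸) :
    HasDerivAt (fun t : ℝ => exp (t • X) * Y * exp (t • (-X))) (X * Y - Y * X) 0 := by
  exact (((hasDerivAt_exp_smul0 X).mul_const Y).mul (hasDerivAt_exp_smul0 (-X))).congr_deriv
    (by simp [sub_eq_add_neg])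

lemma deriv_mem_of_forall {E : Type*} [NormedAddCommGroup E] [NormedSpace ℝ E]
    [FiniteDimensional ℝ E] (p : Submodule ℝ E) (c : ℝ → E)
    (hc : ∀ t, c t ∈ p) (d : E) (hd : HasDerivAt c d 0) : d ∈ p := by
  have hcl : IsClosed (p : Set E) := p.closed_of_finiteDimensional
  refine hcl.mem_of_tendsto hd.tendsto_slope (Eventually.of_forall fun t => ?_)
  rw [slope_def_module]
  exact p.smul_mem _ (p.sub_mem (hc _) (hc _))

lemma bracket_mem_lieOf [FiniteDimensional ℝ 𝔸] {S : Submonoid 𝔸} {hS : IsClosed (S : Set 𝔸)}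
    {X Y : 𝔸} (hX : X ∈ lieOf S hS) (hY : Y ∈ lieOf S hS) : X * Y - Y * X ∈ lieOf S hS := by
  refine deriv_mem_of_forall _ _ (fun t => ?_) _ (hasDerivAt_conj X Y)
  have h' : -X ∈ lieOf S hS := (lieOf S hS).neg_mem hX
  refine conj_mem_lieOf (hX t) (h' t) ?_ ?_ hY
  · rw [smul_neg, exp_mul_neg]
  · rw [smul_neg, exp_neg_mul]

/-- Limit directions belong to the Lie algebra. -/
lemma limit_dir_mem {S : Submonoid 𝔸} {hS : IsClosed (S : Set 𝔸)}
    (hinv : ∀ a ∈ S, ∃ b ∈ S, a * b = 1 ∧ b * a = 1)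
    (y : ℕ → 𝔸) (hy0 : ∀ k, y k ≠ 0) (hy : Tendsto y atTop (𝓝 0)) (hyS : ∀ k, exp (y k) ∈ S)
    (Y : 𝔸) (hY : Tendsto (fun k => ‖y k‖⁻¹ • y k) atTop (𝓝 Y)) : Y ∈ lieOf S hS := by
  have hnn : ∀ t : ℝ, 0 ≤ t → exp (t • Y) ∈ S := by
    intro t ht
    have hn : Tendsto (fun k => ‖y k‖) atTop (𝓝 0) := by simpa using hy.norm
    have h1 : Tendsto (fun k => (⌊t * ‖y k‖⁻¹⌋₊ : ℝ) * ‖y k‖) atTop (𝓝 t) := by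
      have hlow : Tendsto (fun k => t - ‖y k‖) atTop (𝓝 t) := by
        simpa using tendsto_const_nhds.sub hn
      refine tendsto_of_tendsto_of_tendsto_of_le_of_le hlow tendsto_const_nhds ?_ ?_
      · intro k
        have hp : 0 < ‖y k‖ := norm_pos_iff.2 (hy0 k)
        have := (Nat.lt_floor_add_one (t * ‖y k‖⁻¹)).le
        have h2 := mul_le_mul_of_nonneg_right this hp.le
        rw [mul_assoc, inv_mul_cancel₀ hp.ne'] at h2
        simp only; linarith
      · intro k
        have hp : 0 < ‖y k‖ := norm_pos_iff.2 (hy0 k)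
        have := Nat.floor_le (show 0 ≤ t * ‖y k‖⁻¹ by positivity)
        have h2 := mul_le_mul_of_nonneg_right this hp.le
        rw [mul_assoc, inv_mul_cancel₀ hp.ne'] at h2
        simp only; linarith
    have h2 := (continuous_exp'.tendsto (t • Y)).comp (h1.smul hY)
    refine hS.mem_of_tendsto h2 (Eventually.of_forall fun k => ?_)
    have hp : ‖y k‖ ≠ 0 := norm_ne_zero_iff.2 (hy0 k)
    simp only [Function.comp, smul_smul, mul_assoc, mul_inv_cancel₀ hp, mul_one]
    rw [exp_natCast_smul]
    exact S.pow_mem (hyS k) _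
  intro t
  rcases le_total 0 t with ht | ht
  · exact hnn t ht
  · obtain ⟨b, hb, h1, h2⟩ := hinv _ (hnn (-t) (by linarith))
    have h3 : exp (t • Y) = b := by
      have h4 := exp_mul_neg (t • Y)
      rw [neg_smul] at h1
      calc exp (t • Y) = exp (t • Y) * (exp (-(t • Y)) * b) := by rw [h1, mul_one]
        _ = b := by rw [← mul_assoc, h4, one_mul]
    rw [h3]; exact hb

/-- Cartan's theorem, local form. -/
lemma cartan_nhds [FiniteDimensional ℝ 𝔸] {S : Submonoid 𝔸} {hS : IsClosed (S : Set 𝔸)}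
    (hinv : ∀ a ∈ S, ∃ b ∈ S, a * b = 1 ∧ b * a = 1) :
    ∃ U ∈ 𝓝 (1 : 𝔸), ∀ g ∈ S, g ∈ U → ∃ X ∈ lieOf S hS, g = exp X := by
  obtain ⟨q, hq⟩ := (lieOf S hS).exists_isCompl
  set p := lieOf S hS with hp
  let E : (p × q) ≃L[ℝ] 𝔸 := (Submodule.prodEquivOfIsCompl p q hq).toContinuousLinearEquiv
  have hE : ∀ z : p × q, E z = z.1 + z.2 := fun z => by
    simp [E]
  let Φ : p × q → 𝔸 := fun z => exp (z.1 : 𝔸) * exp (z.2 : 𝔸)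
  have hexp : HasStrictFDerivAt (exp : 𝔸 → 𝔸) (1 : 𝔸 →L[ℝ] 𝔸) 0 :=
    hasStrictFDerivAt_exp_zero (𝕂 := ℝ)
  have hΦ : HasStrictFDerivAt Φ (E : (p × q) →L[ℝ] 𝔸) 0 := by
    have h1 : HasStrictFDerivAt (fun z : p × q => exp (z.1 : 𝔸))
        ((1 : 𝔸 →L[ℝ] 𝔸) ∘L (p.subtypeL ∘L ContinuousLinearMap.fst ℝ p q)) 0 :=
      HasStrictFDerivAt.comp (x := (0 : p × q)) (g := exp)
        (f := fun z : p × q => (z.1 : 𝔸)) (by simpa using hexp)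
        (p.subtypeL ∘L ContinuousLinearMap.fst ℝ p q).hasStrictFDerivAt
    have h2 : HasStrictFDerivAt (fun z : p × q => exp (z.2 : 𝔸))
        ((1 : 𝔸 →L[ℝ] 𝔸) ∘L (q.subtypeL ∘L ContinuousLinearMap.snd ℝ p q)) 0 :=
      HasStrictFDerivAt.comp (x := (0 : p × q)) (g := exp)
        (f := fun z : p × q => (z.2 : 𝔸)) (by simpa using hexp)
        (q.subtypeL ∘L ContinuousLinearMap.snd ℝ p q).hasStrictFDerivAt
    refine (h1.mul' h2).congr_fderiv ?_
    ext z <;> simp [hE]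
  have hmap := hΦ.map_nhds_eq_of_equiv
  have hΦ0 : Φ 0 = 1 := by simp [Φ]
  rw [hΦ0] at hmap
  by_contra hcon
  push Not at hcon
  have hex : ∀ k : ℕ, ∃ y : 𝔸, y ∈ q ∧ y ≠ 0 ∧ ‖y‖ < 1 / ((k : ℝ) + 1) ∧ exp y ∈ S := by
    intro k
    have hk : (0 : ℝ) < 1 / ((k : ℝ) + 1) := by positivity
    have hU : Φ '' Metric.ball 0 (1 / ((k : ℝ) + 1)) ∈ 𝓝 (1 : 𝔸) := by
      rw [← hmap]; exact image_mem_map (Metric.ball_mem_nhds _ hk)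
    obtain ⟨g, hgS, ⟨z, hz, rfl⟩, hg⟩ := hcon _ hU
    refine ⟨z.2, z.2.2, ?_, ?_, ?_⟩
    · intro h0
      apply hg z.1 z.1.2
      simp [Φ, h0]
    · rw [Metric.mem_ball, dist_zero_right] at hz
      exact lt_of_le_of_lt (norm_snd_le z) hz
    · have h1 : exp (-(z.1 : 𝔸)) ∈ S := exp_mem_of_mem_lieOf (hS := hS) (p.neg_mem z.1.2)
      have h2 := S.mul_mem h1 hgS
      simp only [Φ] at h2
      rwa [← mul_assoc, exp_neg_mul, one_mul] at h2
  choose y hyq hy0 hyn hyS using hex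
  have : ProperSpace 𝔸 := FiniteDimensional.proper ℝ 𝔸
  have hsph : ∀ k, ‖y k‖⁻¹ • y k ∈ Metric.sphere (0 : 𝔸) 1 := by
    intro k
    simp [norm_smul, hy0 k]
  obtain ⟨Y, hYs, ψ, hψ, hlim⟩ := (isCompact_sphere (0 : 𝔸) 1).tendsto_subseq hsph
  have hy : Tendsto y atTop (𝓝 0) := by
    rw [tendsto_zero_iff_norm_tendsto_zero]
    exact squeeze_zero (fun _ => norm_nonneg _) (fun k => (hyn k).le)
      tendsto_one_div_add_atTop_nhds_zero_nat
  have hYp : Y ∈ p := limit_dir_mem (hS := hS) hinv (fun k => y (ψ k)) (fun k => hy0 _)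
    (hy.comp hψ.tendsto_atTop) (fun k => hyS _) Y hlim
  have hYq : Y ∈ q := by
    refine (q.closed_of_finiteDimensional).mem_of_tendsto hlim (Eventually.of_forall fun k => ?_)
    exact q.smul_mem _ (hyq _)
  have hY0 : Y = 0 := by
    have := hq.disjoint.le_bot (Submodule.mem_inf.2 ⟨hYp, hYq⟩)
    simpa using this
  rw [hY0] at hYs
  simp at hYs

/-- A connected group is contained in any group containing `exp` of its Lie algebra. -/
lemma connected_le [FiniteDimensional ℝ 𝔸] {S : Submonoid 𝔸} {hS : IsClosed (S : Set 𝔸)}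
    (hinv : ∀ a ∈ S, ∃ b ∈ S, a * b = 1 ∧ b * a = 1)
    (hconn : IsPreconnected (S : Set 𝔸)) (T : Submonoid 𝔸)
    (hT : ∀ X ∈ lieOf S hS, exp X ∈ T) : S ≤ T := by
  obtain ⟨U, hU, hUS⟩ := cartan_nhds (hS := hS) hinv
  intro g hg
  have := hconn.induction₂' (fun x y => (x ∈ T → y ∈ T) ∧ (y ∈ T → x ∈ T)) ?_ ?_ S.one_mem hg
  · exact this.1 T.one_mem
  · intro x hx
    obtain ⟨b, hb, hxb, hbx⟩ := hinv x hx
    have hc : ContinuousAt (fun y => b * y) x := by fun_prop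
    have hV : (fun y => b * y) ⁻¹' U ∈ 𝓝 x := hc (by simpa [hbx] using hU)
    have main : ∀ y ∈ S, b * y ∈ U → ((x ∈ T → y ∈ T) ∧ (y ∈ T → x ∈ T)) := by
      intro y hy hyU
      obtain ⟨X, hX, hXe⟩ := hUS _ (S.mul_mem hb hy) hyU
      have hy' : y = x * exp X := by rw [← hXe, ← mul_assoc, hxb, one_mul]
      have hx' : x = y * exp (-X) := by
        rw [hy', mul_assoc, exp_mul_neg, mul_one]
      constructor
      · intro h; rw [hy']; exact T.mul_mem h (hT X hX)
      · intro h; rw [hx']; exact T.mul_mem h (hT _ ((lieOf S hS).neg_mem hX))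
    filter_upwards [self_mem_nhdsWithin, mem_nhdsWithin_of_mem_nhds hV] with y hy hyV
    exact ⟨main y hy hyV, (main y hy hyV).symm⟩
  · intro x y z _ _ _ h1 h2
    exact ⟨fun h => h2.1 (h1.1 h), fun h => h1.2 (h2.2 h)⟩

end LieTools

end

section

open Filter Topology NormedSpace

section LieTools2

variable {𝔸 : Type*} [NormedRing 𝔸] [NormedAlgebra ℝ 𝔸] [CompleteSpace 𝔸]
variable {𝔹 : Type*} [NormedRing 𝔹] [NormedAlgebra ℝ 𝔹] [CompleteSpace 𝔹]

lemma exp_mem_of_closed (p : Submodule ℝ 𝔸) (hp : IsClosed (p : Set 𝔸)) (X : 𝔸)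
    (h : ∀ n : ℕ, X ^ n ∈ p) : exp X ∈ p := by
  have hs := exp_series_hasSum_exp' (𝕂 := ℝ) X
  refine hp.mem_of_tendsto hs (Eventually.of_forall fun s => ?_)
  exact p.sum_mem fun i _ => p.smul_mem _ (h i)

lemma exp_of_sq_zero (X : 𝔸) (h : X * X = 0) : exp X = 1 + X := by
  have hs := exp_series_hasSum_exp' (𝕂 := ℝ) X
  have h2 : HasSum (fun n : ℕ => ((n.factorial : ℝ)⁻¹) • X ^ n) _ :=
    hasSum_sum_of_ne_finset_zero (f := fun n : ℕ => ((n.factorial : ℝ)⁻¹) • X ^ n)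
    (s := Finset.range 2) (by
      intro n hn
      have : 2 ≤ n := by simp at hn; omega
      obtain ⟨k, rfl⟩ := Nat.exists_eq_add_of_le this
      simp [pow_add, pow_two, h])
  have := hs.unique h2
  simpa [Finset.sum_range_succ] using this

/-- The differential of a continuous homomorphism, abstractly. -/
lemma exists_diff_abs [FiniteDimensional ℝ 𝔸] {G : Type*} [Group G] [TopologicalSpace G]
    (ι : G →* 𝔸) (hι : IsInducing ι) (hinj : Function.Injective ι)
    (σ : G →* 𝔹) (hσ : Continuous σ)
    (T : Submodule ℝ 𝔸) (hT : ∀ X ∈ T, ∃ g, ι g = exp X)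
    (hTconj : ∀ X ∈ T, ∀ Y ∈ T, exp X * Y * exp (-X) ∈ T) :
    ∃ φ : T →ₗ[ℝ] 𝔹, (∀ X : T, ∀ g, ι g = exp (X : 𝔸) → σ g = exp (φ X)) ∧
      (∀ X Y Z : T, (Z : 𝔸) = X * Y - Y * X → φ Z = φ X * φ Y - φ Y * φ X) := by
  choose! E hE using hT
  have hsm : ∀ (X : T) (t : ℝ), t • (X : 𝔸) ∈ T := fun X t => T.smul_mem t X.2
  have gen : ∀ X : T, ∃ Y : 𝔹, ∀ t : ℝ, ∀ g, ι g = exp (t • (X : 𝔸)) → σ g = exp (t • Y) := by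
    intro X
    have hcont : Continuous (fun t : ℝ => E (t • (X : 𝔸))) := by
      rw [hι.continuous_iff]
      have : (ι ∘ fun t : ℝ => E (t • (X : 𝔸))) = fun t : ℝ => exp (t • (X : 𝔸)) :=
        funext fun t => hE _ (hsm X t)
      rw [this]
      exact continuous_exp'.comp (by fun_prop)
    obtain ⟨Y, hY⟩ := one_param (fun t : ℝ => σ (E (t • (X : 𝔸)))) (hσ.comp hcont)
      (by
        have : E ((0:ℝ) • (X : 𝔸)) = 1 := hinj (by rw [hE _ (hsm X 0)]; simp)
        rw [this, map_one])
      (by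
        intro s t
        have : E ((s + t) • (X : 𝔸)) = E (s • (X : 𝔸)) * E (t • (X : 𝔸)) := hinj (by
          rw [map_mul, hE _ (hsm X _), hE _ (hsm X _), hE _ (hsm X _), exp_add_smul'])
        rw [this, map_mul])
    refine ⟨Y, fun t g hg => ?_⟩
    have : g = E (t • (X : 𝔸)) := hinj (by rw [hg, hE _ (hsm X t)])
    rw [this]; exact hY t
  choose ψ hψ using gen
  have huniq : ∀ (X : T) Z, (∀ t : ℝ, ∀ g, ι g = exp (t • (X : 𝔸)) → σ g = exp (t • Z)) →
      ψ X = Z := by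
    intro X Z h
    refine exp_smul_inj fun t => ?_
    rw [← h t _ (hE _ (hsm X t)), ← hψ X t _ (hE _ (hsm X t))]
  let φ : T →ₗ[ℝ] 𝔹 :=
    { toFun := ψ
      map_add' := by
        intro X Y
        refine huniq _ _ fun t g hg => ?_
        have hX : ∀ s : ℝ, (s • t • (X : 𝔸)) ∈ T := fun s => T.smul_mem _ (hsm X t)
        have hY : ∀ s : ℝ, (s • t • (Y : 𝔸)) ∈ T := fun s => T.smul_mem _ (hsm Y t)
        have h1 := pow_tendsto_exp _ _ (by simp) (hasDerivAt_exp_mul_exp (X : 𝔸) Y t)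
        have h2 := pow_tendsto_exp _ _ (by simp) (hasDerivAt_exp_mul_exp (ψ X) (ψ Y) t)
        have h1' : Tendsto (fun k : ℕ =>
            (E ((k:ℝ)⁻¹ • t • (X : 𝔸)) * E ((k:ℝ)⁻¹ • t • (Y : 𝔸))) ^ k) atTop (𝓝 g) := by
          rw [hι.tendsto_nhds_iff, hg]
          refine h1.congr fun k => ?_
          simp only [Function.comp, map_pow, map_mul, hE _ (hX _), hE _ (hY _)]
        have h3 := (hσ.tendsto g).comp h1'
        refine tendsto_nhds_unique h3 (h2.congr fun k => ?_)
        have e1 := hψ X ((k:ℝ)⁻¹ * t) (E ((k:ℝ)⁻¹ • t • (X : 𝔸))) (by rw [hE _ (hX _), smul_smul])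
        have e2 := hψ Y ((k:ℝ)⁻¹ * t) (E ((k:ℝ)⁻¹ • t • (Y : 𝔸))) (by rw [hE _ (hY _), smul_smul])
        rw [smul_smul, smul_smul, ← e1, ← e2]
        simp
      map_smul' := by
        intro c X
        refine huniq _ _ fun t g hg => ?_
        rw [RingHom.id_apply, smul_smul]
        apply hψ
        rw [hg, Submodule.coe_smul, smul_smul] }
  have hφψ : ∀ X, φ X = ψ X := fun X => rfl
  refine ⟨φ, ?_, ?_⟩
  · intro X g hg
    have := hψ X 1 g (by simpa using hg)
    rw [one_smul] at this
    exact this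
  · intro X Y Z hZ
    have hX : ∀ t : ℝ, t • (X : 𝔸) ∈ T := hsm X
    have hmem : ∀ t : ℝ, exp (t • (X : 𝔸)) * Y * exp (t • (-(X : 𝔸))) ∈ T := by
      intro t
      rw [smul_neg]
      exact hTconj _ (hX t) _ Y.2
    have hconj : ∀ t : ℝ, φ ⟨_, hmem t⟩ = exp (t • φ X) * φ Y * exp (t • (-φ X)) := by
      intro t
      have hab : exp (t • (X : 𝔸)) * exp (t • -(X : 𝔸)) = 1 := by rw [smul_neg, exp_mul_neg]
      have hba : exp (t • -(X : 𝔸)) * exp (t • (X : 𝔸)) = 1 := by rw [smul_neg, exp_neg_mul]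
      have hab' : exp (t • φ X) * exp (t • -φ X) = 1 := by rw [smul_neg, exp_mul_neg]
      have hba' : exp (t • -φ X) * exp (t • φ X) = 1 := by rw [smul_neg, exp_neg_mul]
      apply huniq
      intro s g hg
      have hg' : g = E (t • (X : 𝔸)) * E (s • (Y : 𝔸)) * E ((-t) • (X : 𝔸)) := by
        apply hinj
        rw [hg, map_mul, map_mul, hE _ (hX _), hE _ (hX _), hE _ (hsm Y _)]
        rw [show s • (exp (t • (X : 𝔸)) * (Y : 𝔸) * exp (t • -(X : 𝔸))) =
          exp (t • (X : 𝔸)) * (s • (Y : 𝔸)) * exp (t • -(X : 𝔸)) by simp, exp_conj_of hab hba]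
        simp
      rw [show s • (exp (t • φ X) * φ Y * exp (t • -φ X)) =
        exp (t • φ X) * (s • φ Y) * exp (t • -φ X) by simp, exp_conj_of hab' hba']
      have e1 := hψ X t _ (hE _ (hX t))
      have e2 := hψ Y s _ (hE _ (hsm Y s))
      have e3 := hψ X (-t) _ (hE _ (hX (-t)))
      rw [hg', map_mul, map_mul, hφψ, hφψ, smul_neg, ← neg_smul, e1, e2, e3]
    obtain ⟨Φ, hΦ⟩ := LinearMap.exists_extend φ
    have hΦ' : ∀ X : T, Φ X = φ X := fun X => by rw [← hΦ]; rfl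
    have h1 := (LinearMap.toContinuousLinearMap Φ).hasFDerivAt.comp_hasDerivAt (0:ℝ)
      (hasDerivAt_conj (X : 𝔸) Y)
    have h2 := hasDerivAt_conj (φ X) (φ Y)
    have h3 := h1.unique (h2.congr_of_eventuallyEq (Eventually.of_forall fun t => by
      change Φ (exp (t • (X:𝔸)) * Y * exp (t • -(X:𝔸))) =
        exp (t • φ X) * φ Y * exp (t • -φ X)
      rw [← hconj t, ← hΦ']))
    rw [← hΦ', hZ]
    exact h3

end LieTools2

end

section

open Filter Topology NormedSpace

section MatrixTools

attribute [local instance] Matrix.linftyOpNormedRing Matrix.linftyOpNormedAlgebra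

variable {n : Type*} [Fintype n] [DecidableEq n]

local instance matComplete : CompleteSpace (Matrix n n ℂ) := FiniteDimensional.complete ℝ _

/-- matrix exponential -/
noncomputable def mexp (X : Matrix n n ℂ) : Matrix n n ℂ := NormedSpace.exp X

lemma mexp_zero : mexp (0 : Matrix n n ℂ) = 1 := exp_zero

lemma mexp_add_smul (X : Matrix n n ℂ) (s t : ℝ) :
    mexp ((s + t) • X) = mexp (s • X) * mexp (t • X) := exp_add_smul' X s t

lemma mexp_neg_mul (X : Matrix n n ℂ) : mexp (-X) * mexp X = 1 := exp_neg_mul X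

lemma mexp_mul_neg (X : Matrix n n ℂ) : mexp X * mexp (-X) = 1 := exp_mul_neg X

lemma mexp_sq_zero (X : Matrix n n ℂ) (h : X * X = 0) : mexp X = 1 + X := exp_of_sq_zero X h

lemma mexp_conj {a b : Matrix n n ℂ} (hab : a * b = 1) (hba : b * a = 1) (X : Matrix n n ℂ) :
    mexp (a * X * b) = a * mexp X * b := exp_conj_of hab hba X

lemma mexp_transpose (X : Matrix n n ℂ) : mexp X.transpose = (mexp X).transpose :=
  Matrix.exp_transpose X

lemma mexp_diagonal (v : n → ℂ) :
    mexp (Matrix.diagonal v) = Matrix.diagonal (fun i => Complex.exp (v i)) := by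
  refine (Matrix.exp_diagonal v).trans ?_
  congr 1
  funext i
  rw [Complex.exp_eq_exp_ℂ]
  exact Pi.coe_exp v i

lemma mexp_mem (p : Submodule ℝ (Matrix n n ℂ)) (X : Matrix n n ℂ)
    (h : ∀ k : ℕ, X ^ k ∈ p) : mexp X ∈ p :=
  exp_mem_of_closed p p.closed_of_finiteDimensional X h

lemma mexp_eigen (X : Matrix n n ℂ) (v : n → ℂ) (c : ℂ) (h : X.mulVec v = c • v) :
    (mexp X).mulVec v = Complex.exp c • v := by
  have hk : ∀ k : ℕ, (X ^ k).mulVec v = (c ^ k) • v := by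
    intro k
    induction k with
    | zero => simp
    | succ k ih => rw [pow_succ, ← Matrix.mulVec_mulVec, h, Matrix.mulVec_smul, ih, smul_smul,
        pow_succ, mul_comm]
  let L : Matrix n n ℂ →ₗ[ℝ] (n → ℂ) :=
    { toFun := fun A => A.mulVec v
      map_add' := fun A B => Matrix.add_mulVec A B v
      map_smul' := fun r A => Matrix.smul_mulVec r A v }
  have h1 : HasSum (fun k : ℕ => ((k.factorial : ℝ)⁻¹) • (X ^ k)) (mexp X) :=
    exp_series_hasSum_exp' (𝕂 := ℝ) X
  have h2 := h1.mapL (LinearMap.toContinuousLinearMap L)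
  have h3 : HasSum (fun k : ℕ => ((k.factorial : ℝ)⁻¹) • (c ^ k)) (exp c) :=
    exp_series_hasSum_exp' (𝕂 := ℝ) c
  have h4 := h3.smul_const v
  rw [← Complex.exp_eq_exp_ℂ] at h4
  refine h2.unique ?_
  have h5 : (fun k : ℕ => ((k.factorial : ℝ)⁻¹ • (c ^ k)) • v) =
      fun k : ℕ => (LinearMap.toContinuousLinearMap L) (((k.factorial : ℝ)⁻¹) • (X ^ k)) := by
    funext k
    change _ = ((((k.factorial : ℝ)⁻¹) • (X ^ k))).mulVec v
    rw [Matrix.smul_mulVec, hk, smul_assoc]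
  rw [h5] at h4
  exact h4

lemma hasDerivAt_det_exp (X : Matrix n n ℂ) :
    HasDerivAt (fun t : ℝ => (mexp (t • X)).det) X.trace 0 := by
  have hdiff : Differentiable ℝ (fun A : Matrix n n ℂ => A.det) := by
    have he : ∀ i j, Differentiable ℝ (fun A : Matrix n n ℂ => A i j) := fun i j =>
      (LinearMap.toContinuousLinearMap
        (Matrix.entryLinearMap ℝ ℂ i j : Matrix n n ℂ →ₗ[ℝ] ℂ)).differentiable
    simp only [Matrix.det_apply']
    refine Differentiable.fun_sum fun σ _ => ?_
    refine Differentiable.const_mul ?_ _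
    intro A
    exact (HasFDerivAt.finsetProd (fun i _ => (he (σ i) i A).hasFDerivAt)).differentiableAt
  have hd := (hdiff 1).hasFDerivAt
  set D := fderiv ℝ (fun A : Matrix n n ℂ => A.det) 1
  have hDX : D X = X.trace := by
    have h1 : HasDerivAt (fun t : ℝ => (1 + t • X)) X 0 :=
      (((hasDerivAt_id (0:ℝ)).smul_const X).const_add 1).congr_deriv (one_smul ℝ X)
    have h2 : HasDerivAt (fun t : ℝ => (1 + t • X).det) (D X) 0 := by
      have hd' : HasFDerivAt (fun A : Matrix n n ℂ => A.det) D (1 + (0:ℝ) • X) := by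
        have e : 1 + (0:ℝ) • X = 1 := by rw [zero_smul, add_zero]
        rw [e]; exact hd
      exact hd'.comp_hasDerivAt (0:ℝ) h1
    have h3 : HasDerivAt (fun t : ℝ => (1 + t • X).det) X.trace 0 := by
      have h4 : (fun t : ℝ => (1 + t • X).det) = fun t : ℝ => 1 + X.trace * (t:ℂ) +
          ((Matrix.det (1 + (Polynomial.X : Polynomial ℂ) • X.map Polynomial.C)).divX.divX).eval (t:ℂ) * (t:ℂ)^2 := by
        funext t
        have := Matrix.det_one_add_smul (t:ℂ) X
        rw [← this]
        congr 2
      rw [h4]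
      have hof : HasDerivAt (fun t : ℝ => (t:ℂ)) 1 0 := by
        exact Complex.ofRealCLM.hasDerivAt
      have hp : HasDerivAt (fun t : ℝ => ((Matrix.det (1 + (Polynomial.X : Polynomial ℂ) • X.map Polynomial.C)).divX.divX).eval (t:ℂ)) _ 0 :=
        (Polynomial.hasDerivAt _ ((0:ℝ):ℂ)).comp_ofReal
      have := ((hof.const_mul X.trace).const_add 1).add (hp.mul (hof.pow 2))
      exact this.congr_deriv (by simp)
    exact h2.unique h3
  have h5 : HasFDerivAt (fun A : Matrix n n ℂ => A.det) D (exp ((0:ℝ) • X)) := by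
    have e : exp ((0:ℝ) • X) = 1 := by rw [zero_smul]; exact exp_zero
    exact e ▸ hd
  exact (h5.comp_hasDerivAt (0:ℝ) (hasDerivAt_exp_smul0 X)).congr_deriv hDX

lemma det_mexp {X : Matrix n n ℂ} (h : X.trace = 0) : (mexp X).det = 1 := by
  have hd : ∀ t, HasDerivAt (fun t : ℝ => (mexp (t • X)).det) 0 t := by
    intro t
    have h1 := hasDerivAt_det_exp X
    rw [h] at h1
    have h2 : HasDerivAt (fun s : ℝ => (mexp ((s - t) • X)).det) 0 t := by
      have : HasDerivAt (fun t : ℝ => (mexp (t • X)).det) 0 (t - t) := by rwa [sub_self]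
      exact this.comp_sub_const t t
    have h3 := h2.const_mul ((mexp (t • X)).det)
    rw [mul_zero] at h3
    refine h3.congr_of_eventuallyEq (Eventually.of_forall fun s => ?_)
    change (mexp (s • X)).det = (mexp (t • X)).det * (mexp ((s - t) • X)).det
    rw [← Matrix.det_mul, ← mexp_add_smul]
    congr 3; ring
  have := is_const_of_deriv_eq_zero (fun t => (hd t).differentiableAt)
    (fun t => (hd t).deriv) 1 0
  simpa [mexp_zero] using this

lemma trace_eq_zero_of_det_exp {X : Matrix n n ℂ} (h : ∀ t : ℝ, (mexp (t • X)).det = 1) :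
    X.trace = 0 := by
  have h1 := hasDerivAt_det_exp X
  simp only [h] at h1
  exact h1.unique (hasDerivAt_const _ _)

/-- coercion `SL → Matrix` -/
def slHom (n : Type*) [Fintype n] [DecidableEq n] :
    Matrix.SpecialLinearGroup n ℂ →* Matrix n n ℂ where
  toFun g := g
  map_one' := rfl
  map_mul' _ _ := rfl

lemma slHom_inj : Function.Injective (slHom n) := Subtype.val_injective

lemma sl_closedEmbedding : IsClosedEmbedding (slHom n) where
  eq_induced := rfl
  injective := slHom_inj
  isClosed_range := by
    have : Set.range (slHom n) = {A : Matrix n n ℂ | A.det = 1} := by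
      ext A
      constructor
      · rintro ⟨g, rfl⟩; exact g.2
      · intro h; exact ⟨⟨A, h⟩, rfl⟩
    rw [this]
    exact isClosed_eq (Continuous.matrix_det continuous_id) continuous_const

/-- a subgroup of `SL` as a submonoid of matrices -/
def subM (F : Subgroup (Matrix.SpecialLinearGroup n ℂ)) : Submonoid (Matrix n n ℂ) :=
  F.toSubmonoid.map (slHom n)

lemma mem_subM {F : Subgroup (Matrix.SpecialLinearGroup n ℂ)} {A : Matrix n n ℂ} :
    A ∈ subM F ↔ ∃ g ∈ F, (g : Matrix n n ℂ) = A := Iff.rfl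

lemma coe_mem_subM {F : Subgroup (Matrix.SpecialLinearGroup n ℂ)}
    {g : Matrix.SpecialLinearGroup n ℂ} : (g : Matrix n n ℂ) ∈ subM F ↔ g ∈ F := by
  constructor
  · rintro ⟨g', h, h'⟩
    have : g' = g := Subtype.val_injective h'
    rwa [← this]
  · intro h; exact ⟨g, h, rfl⟩

lemma subM_inv (F : Subgroup (Matrix.SpecialLinearGroup n ℂ)) :
    ∀ a ∈ subM F, ∃ b ∈ subM F, a * b = 1 ∧ b * a = 1 := by
  rintro a ⟨g, hg, rfl⟩
  refine ⟨slHom n g⁻¹, ⟨g⁻¹, F.inv_mem hg, rfl⟩, ?_, ?_⟩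
  · rw [← map_mul]; simp
  · rw [← map_mul]; simp

/-- The Lie algebra of a closed connected subgroup. -/
lemma exists_lie (F : Subgroup (Matrix.SpecialLinearGroup n ℂ))
    (hF : IsClosed (F : Set (Matrix.SpecialLinearGroup n ℂ)))
    (hFc : IsConnected (F : Set (Matrix.SpecialLinearGroup n ℂ))) :
    ∃ 𝔤 : Submodule ℝ (Matrix n n ℂ),
      (∀ X, X ∈ 𝔤 ↔ ∀ t : ℝ, mexp (t • X) ∈ subM F) ∧
      (∀ X ∈ 𝔤, ∀ Y ∈ 𝔤, X * Y - Y * X ∈ 𝔤) ∧ (∀ X ∈ 𝔤, X.trace = 0) ∧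
      (∀ X ∈ 𝔤, mexp X ∈ subM F) ∧
      (∀ T : Submonoid (Matrix n n ℂ), (∀ X ∈ 𝔤, mexp X ∈ T) → subM F ≤ T) := by
  have hc : IsClosed (subM F : Set (Matrix n n ℂ)) := sl_closedEmbedding.isClosedMap _ hF
  have hcn : IsPreconnected (subM F : Set (Matrix n n ℂ)) :=
    hFc.isPreconnected.image _ sl_closedEmbedding.continuous.continuousOn
  refine ⟨lieOf (subM F) hc, fun X => Iff.rfl, fun X hX Y hY => bracket_mem_lieOf hX hY, ?_,
    fun X hX => exp_mem_of_mem_lieOf hX, fun T hT => connected_le (subM_inv F) hcn T hT⟩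
  intro X hX
  refine trace_eq_zero_of_det_exp fun t => ?_
  obtain ⟨g, _, hg⟩ := hX t
  have : mexp (t • X) = (g : Matrix n n ℂ) := hg.symm
  rw [this]
  exact g.2

/-- The differential of a continuous homomorphism. -/
lemma exists_diff (ρ : Matrix.SpecialLinearGroup (Fin 2) ℂ →* Matrix.SpecialLinearGroup (Fin 4) ℂ)
    (hρ : Continuous ρ) :
    ∃ φ : (LinearMap.ker (Matrix.traceLinearMap (Fin 2) ℝ ℂ)) →ₗ[ℝ] Matrix (Fin 4) (Fin 4) ℂ,
      (∀ X : LinearMap.ker (Matrix.traceLinearMap (Fin 2) ℝ ℂ), ∀ g : Matrix.SpecialLinearGroup (Fin 2) ℂ,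
        (g : Matrix (Fin 2) (Fin 2) ℂ) = mexp (X : Matrix (Fin 2) (Fin 2) ℂ) →
          (ρ g : Matrix (Fin 4) (Fin 4) ℂ) = mexp (φ X)) ∧
      (∀ X Y Z : LinearMap.ker (Matrix.traceLinearMap (Fin 2) ℝ ℂ),
        (Z : Matrix (Fin 2) (Fin 2) ℂ) = X * Y - Y * X →
        φ Z = φ X * φ Y - φ Y * φ X) := by
  refine exists_diff_abs (slHom (Fin 2)) sl_closedEmbedding.isInducing slHom_inj
    ((slHom (Fin 4)).comp ρ) (sl_closedEmbedding.continuous.comp hρ)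
    (LinearMap.ker (Matrix.traceLinearMap (Fin 2) ℝ ℂ)) ?_ ?_
  · intro X hX
    exact ⟨⟨mexp X, det_mexp hX⟩, rfl⟩
  · intro X hX Y hY
    change Matrix.trace (mexp X * Y * mexp (-X)) = 0
    rw [Matrix.trace_mul_comm, ← mul_assoc, mexp_neg_mul, one_mul]
    exact hY

end MatrixTools

end

section

section Sl2Tools

variable {V : Type*} [AddCommGroup V] [Module ℂ V] [FiniteDimensional ℂ V]

lemma eventually_zero (h : Module.End ℂ V) (x : ℕ → V) (μ : ℕ → ℂ) (hμ : Function.Injective μ)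
    (hx : ∀ k, h (x k) = μ k • x k) : ∃ k, x k = 0 := by
  by_contra! hne
  have hli := Module.End.eigenvectors_linearIndependent' h μ hμ x
    (fun k => ⟨Module.End.mem_eigenspace_iff.2 (hx k), hne k⟩)
  have := hli.finite
  exact not_finite ℕ

/-- highest weight vector in an invariant subspace -/
lemma exists_hw (h e : Module.End ℂ V) (hhe : h * e - e * h = (2:ℂ) • e)
    (W : Submodule ℂ V) (hW : W ≠ ⊥) (hWh : ∀ w ∈ W, h w ∈ W) (hWe : ∀ w ∈ W, e w ∈ W) :
    ∃ v ∈ W, v ≠ 0 ∧ e v = 0 ∧ ∃ a : ℂ, h v = a • v := by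
  have : Nontrivial W := Submodule.nontrivial_iff_ne_bot.2 hW
  obtain ⟨a, ha⟩ := Module.End.exists_eigenvalue (h.restrict hWh)
  obtain ⟨v, hv⟩ := ha.exists_hasEigenvector
  have hv1 : h v = a • (v : V) := congrArg Subtype.val (Module.End.mem_eigenspace_iff.1 hv.1)
  have hv0 : (v : V) ≠ 0 := fun hz => hv.2 (Subtype.ext hz)
  have hcomm : ∀ x, h (e x) = e (h x) + (2:ℂ) • e x := by
    intro x
    have := LinearMap.congr_fun hhe x
    simp only [LinearMap.sub_apply, Module.End.mul_apply, LinearMap.smul_apply] at this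
    rw [← this]; abel
  have hk : ∀ k : ℕ, h ((e ^ k) v) = (a + 2 * k) • (e ^ k) v := by
    intro k
    induction k with
    | zero => simpa using hv1
    | succ k ih =>
      rw [pow_succ', Module.End.mul_apply, hcomm, ih, map_smul, ← add_smul]
      congr 1; push_cast; ring
  have hmem : ∀ k : ℕ, (e ^ k) v ∈ W := by
    intro k
    induction k with
    | zero => simp
    | succ k ih => rw [pow_succ', Module.End.mul_apply]; exact hWe _ ih
  have hex : ∃ k, (e ^ k) (v : V) = 0 := by
    refine eventually_zero h _ (fun k => a + 2 * k) ?_ hk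
    intro i j hij
    simpa using hij
  classical
  obtain ⟨m, hm⟩ : ∃ m, Nat.find hex = m + 1 := by
    refine Nat.exists_eq_succ_of_ne_zero ?_
    intro h0
    have := Nat.find_spec hex
    rw [h0] at this
    exact hv0 (by simpa using this)
  refine ⟨(e ^ m) v, hmem m, Nat.find_min hex (by omega), ?_, _, hk m⟩
  have := Nat.find_spec hex
  rwa [hm, pow_succ', Module.End.mul_apply] at this

/-- the string through a highest weight vector -/
lemma hw_string (h e f : Module.End ℂ V) (hhf : h * f - f * h = (-2:ℂ) • f)
    (hef : e * f - f * e = h) (v : V) (hv : v ≠ 0) (hev : e v = 0) (a : ℂ) (ha : h v = a • v) :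
    (∀ k : ℕ, h ((f ^ k) v) = (a - 2 * k) • (f ^ k) v) ∧
    (∀ k : ℕ, e ((f ^ (k+1)) v) = ((k + 1) * (a - k)) • (f ^ k) v) ∧
    ∃ n : ℕ, a = n ∧ (f ^ (n+1)) v = 0 ∧ ∀ k ≤ n, (f ^ k) v ≠ 0 := by
  have hcomm : ∀ x, h (f x) = f (h x) + (-2:ℂ) • f x := by
    intro x
    have := LinearMap.congr_fun hhf x
    simp only [LinearMap.sub_apply, Module.End.mul_apply, LinearMap.smul_apply] at this
    rw [← this]; abel
  have hcomm2 : ∀ x, e (f x) = f (e x) + h x := by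
    intro x
    have := LinearMap.congr_fun hef x
    simp only [LinearMap.sub_apply, Module.End.mul_apply] at this
    rw [← this]; abel
  have hk : ∀ k : ℕ, h ((f ^ k) v) = (a - 2 * k) • (f ^ k) v := by
    intro k
    induction k with
    | zero => simpa using ha
    | succ k ih =>
      rw [pow_succ', Module.End.mul_apply, hcomm, ih, map_smul, ← add_smul]
      congr 1; push_cast; ring
  have he : ∀ k : ℕ, e ((f ^ (k+1)) v) = ((k + 1) * (a - k)) • (f ^ k) v := by
    intro k
    induction k with
    | zero => rw [pow_succ', Module.End.mul_apply, hcomm2]; simp [hev, ha]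
    | succ k ih =>
      rw [pow_succ' f (k+1), Module.End.mul_apply, hcomm2, ih, hk, map_smul, pow_succ' f k,
        Module.End.mul_apply, ← add_smul]
      congr 1; push_cast; ring
  refine ⟨hk, he, ?_⟩
  have hex : ∃ k, (f ^ k) v = 0 := by
    refine eventually_zero h _ (fun k => a - 2 * k) ?_ hk
    intro i j hij
    simpa using hij
  classical
  obtain ⟨m, hm⟩ : ∃ m, Nat.find hex = m + 1 := by
    refine Nat.exists_eq_succ_of_ne_zero ?_
    intro h0
    have := Nat.find_spec hex
    rw [h0] at this
    exact hv (by simpa using this)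
  have hz := Nat.find_spec hex
  rw [hm] at hz
  have hne : ∀ k ≤ m, (f ^ k) v ≠ 0 := fun k hk => Nat.find_min hex (by omega)
  refine ⟨m, ?_, hz, hne⟩
  have h1 := he m
  rw [hz, map_zero] at h1
  rcases smul_eq_zero.1 h1.symm with h2 | h2
  · rcases mul_eq_zero.1 h2 with h3 | h3
    · exact absurd h3 (by exact_mod_cast Nat.succ_ne_zero m)
    · exact sub_eq_zero.1 h3
  · exact absurd h2 (hne m le_rfl)

/-- The hypotheses on a pair of commuting triples. -/
structure PairTriple (h1 e1 f1 h2 e2 f2 : Module.End ℂ V) : Prop where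
  he1 : h1 * e1 - e1 * h1 = (2:ℂ) • e1
  hf1 : h1 * f1 - f1 * h1 = (-2:ℂ) • f1
  ef1 : e1 * f1 - f1 * e1 = h1
  he2 : h2 * e2 - e2 * h2 = (2:ℂ) • e2
  hf2 : h2 * f2 - f2 * h2 = (-2:ℂ) • f2
  ef2 : e2 * f2 - f2 * e2 = h2
  chh : Commute h1 h2
  che : Commute h1 e2
  chf : Commute h1 f2
  ceh : Commute e1 h2
  cee : Commute e1 e2
  cef : Commute e1 f2
  cfh : Commute f1 h2
  cfe : Commute f1 e2
  cff : Commute f1 f2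

lemma Commute.ap {a b : Module.End ℂ V} (h : Commute a b) (v : V) : a (b v) = b (a v) :=
  LinearMap.congr_fun h v

lemma pair_hw [Nontrivial V] {h1 e1 f1 h2 e2 f2 : Module.End ℂ V}
    (T : PairTriple h1 e1 f1 h2 e2 f2) :
    ∃ v : V, v ≠ 0 ∧ e1 v = 0 ∧ e2 v = 0 ∧ ∃ a b : ℂ, h1 v = a • v ∧ h2 v = b • v := by
  obtain ⟨v, -, hv0, hev, a, ha⟩ := exists_hw h1 e1 T.he1 ⊤ top_ne_bot (fun _ _ => trivial)
    (fun _ _ => trivial)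
  let W : Submodule ℂ V := LinearMap.ker e1 ⊓ Module.End.eigenspace h1 a
  have hW : ∀ w, w ∈ W ↔ e1 w = 0 ∧ h1 w = a • w := fun w => by
    simp [W, Module.End.mem_eigenspace_iff]
  obtain ⟨w, hw, hw0, hew, b, hb⟩ := exists_hw h2 e2 T.he2 W
    (fun hbot => hv0 (by
      have : v ∈ W := (hW v).2 ⟨hev, ha⟩
      rw [hbot] at this
      simpa using this))
    (fun w hw => by
      rw [hW] at hw ⊢
      rw [T.ceh.ap, T.chh.ap, hw.1, hw.2]; simp)
    (fun w hw => by
      rw [hW] at hw ⊢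
      rw [T.cee.ap, T.che.ap, hw.1, hw.2]; simp)
  exact ⟨w, hw0, ((hW w).1 hw).1, hew, a, b, ((hW w).1 hw).2, hb⟩

lemma pair_dim {h1 e1 f1 h2 e2 f2 : Module.End ℂ V}
    (T : PairTriple h1 e1 f1 h2 e2 f2) (v : V) (hv : v ≠ 0) (he1 : e1 v = 0) (he2 : e2 v = 0)
    (m n : ℕ) (hm : h1 v = (m:ℂ) • v) (hn : h2 v = (n:ℂ) • v) :
    (m + 1) * (n + 1) ≤ Module.finrank ℂ V := by
  obtain ⟨k2, -, n', hn', -, hne2⟩ := hw_string h2 e2 f2 T.hf2 T.ef2 v hv he2 n hn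
  obtain rfl : n = n' := by exact_mod_cast hn'
  have hA : ∀ j : ℕ, e1 ((f2 ^ j) v) = 0 := fun j => by
    rw [(T.cef.pow_right j).ap, he1, map_zero]
  have hB : ∀ j : ℕ, h1 ((f2 ^ j) v) = (m:ℂ) • (f2 ^ j) v := fun j => by
    rw [(T.chf.pow_right j).ap, hm, map_smul]
  have hC : ∀ j ≤ n, ∀ i ≤ m, (f1 ^ i) ((f2 ^ j) v) ≠ 0 := by
    intro j hj
    obtain ⟨-, -, m', hm', -, hne⟩ := hw_string h1 e1 f1 T.hf1 T.ef1 _ (hne2 j hj) (hA j) m (hB j)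
    obtain rfl : m = m' := by exact_mod_cast hm'
    exact hne
  have hD : ∀ j ≤ n, ∀ i : ℕ, h1 ((f1 ^ i) ((f2 ^ j) v)) =
      ((m:ℂ) - 2 * i) • (f1 ^ i) ((f2 ^ j) v) := fun j hj =>
    (hw_string h1 e1 f1 T.hf1 T.ef1 _ (hne2 j hj) (hA j) m (hB j)).1
  have hE : ∀ i j : ℕ, h2 ((f1 ^ i) ((f2 ^ j) v)) =
      ((n:ℂ) - 2 * j) • (f1 ^ i) ((f2 ^ j) v) := fun i j => by
    rw [← (T.cfh.pow_left i).ap, k2, map_smul]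
  let x : Fin (m+1) × Fin (n+1) → V := fun p => (f1 ^ (p.1:ℕ)) ((f2 ^ (p.2:ℕ)) v)
  let μ : Fin (m+1) × Fin (n+1) → ℂ := fun p =>
    ((m:ℂ) - 2 * (p.1:ℕ)) + (m + 1) * ((n:ℂ) - 2 * (p.2:ℕ))
  have hμ : Function.Injective μ := by
    rintro ⟨i, j⟩ ⟨i', j'⟩ hij
    have h2 : ((i:ℕ):ℂ) + (m+1) * (j:ℕ) = (i':ℕ) + (m+1) * (j':ℕ) := by
      simp only [μ] at hij
      linear_combination (-1/2) * hij
    have h3 : (i:ℕ) + (m+1) * (j:ℕ) = (i':ℕ) + (m+1) * (j':ℕ) := by exact_mod_cast h2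
    have h4 : (i:ℕ) = i' := by
      have := congrArg (· % (m+1)) h3
      simpa [Nat.add_mul_mod_self_left, Nat.mod_eq_of_lt i.2, Nat.mod_eq_of_lt i'.2] using this
    have h5 : (j:ℕ) = j' := by
      rw [h4] at h3
      exact Nat.eq_of_mul_eq_mul_left (Nat.succ_pos m) (Nat.add_left_cancel h3)
    exact Prod.ext (Fin.ext h4) (Fin.ext h5)
  have hli := Module.End.eigenvectors_linearIndependent' (h1 + ((m:ℂ) + 1) • h2) μ hμ x (by
    rintro ⟨i, j⟩
    refine ⟨Module.End.mem_eigenspace_iff.2 ?_, hC j (by omega) i (by omega)⟩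
    simp only [x, μ, LinearMap.add_apply, LinearMap.smul_apply]
    rw [hD j (by omega), hE, smul_smul, ← add_smul])
  simpa using hli.fintype_card_le_finrank

/-- once the second highest weight is zero -/
lemma pair_zero {h1 e1 f1 h2 e2 f2 : Module.End ℂ V}
    (T : PairTriple h1 e1 f1 h2 e2 f2)
    (hirr : ∀ W : Submodule ℂ V, (∀ w ∈ W, h1 w ∈ W ∧ e1 w ∈ W ∧ f1 w ∈ W ∧ h2 w ∈ W ∧
      e2 w ∈ W ∧ f2 w ∈ W) → W = ⊥ ∨ W = ⊤)
    (hdim : Module.finrank ℂ V = 4)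
    (v : V) (hv : v ≠ 0) (he1 : e1 v = 0) (he2 : e2 v = 0)
    (m : ℕ) (hm : h1 v = (m:ℂ) • v) (hn : h2 v = 0) :
    h2 = 0 ∧ e2 = 0 ∧ f2 = 0 ∧ ∃ x : Fin 4 → V, LinearIndependent ℂ x ∧
      h1 (x 0) = (3:ℂ) • x 0 ∧ h1 (x 1) = x 1 ∧ h1 (x 2) = -x 2 ∧ h1 (x 3) = (-3:ℂ) • x 3 ∧
      e1 (x 0) = 0 ∧ e1 (x 1) = (3:ℂ) • x 0 ∧ e1 (x 2) = (4:ℂ) • x 1 ∧ e1 (x 3) = (3:ℂ) • x 2 ∧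
      f1 (x 0) = x 1 ∧ f1 (x 1) = x 2 ∧ f1 (x 2) = x 3 ∧ f1 (x 3) = 0 := by
  have hn' : h2 v = ((0:ℕ):ℂ) • v := by simp [hn]
  have hd := pair_dim T v hv he1 he2 m 0 hm hn'
  obtain ⟨k2, -, n', hz, hf2, -⟩ := hw_string h2 e2 f2 T.hf2 T.ef2 v hv he2 _ hn'
  obtain rfl : 0 = n' := by exact_mod_cast hz
  have hf2 : f2 v = 0 := by simpa using hf2
  let W : Submodule ℂ V := LinearMap.ker h2 ⊓ LinearMap.ker e2 ⊓ LinearMap.ker f2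
  have hW : ∀ w, w ∈ W ↔ (h2 w = 0 ∧ e2 w = 0) ∧ f2 w = 0 := fun w => by simp [W]
  have hWtop : W = ⊤ := by
    refine (hirr W ?_).resolve_left ?_
    · intro w hw
      have hw' := hw
      rw [hW] at hw'
      obtain ⟨⟨a, b⟩, c⟩ := hw'
      rw [a, b, c]
      refine ⟨(hW _).2 ?_, (hW _).2 ?_, (hW _).2 ?_, W.zero_mem, W.zero_mem, W.zero_mem⟩
      · rw [← T.chh.ap, ← T.che.ap, ← T.chf.ap, a, b, c]; simp
      · rw [← T.ceh.ap, ← T.cee.ap, ← T.cef.ap, a, b, c]; simp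
      · rw [← T.cfh.ap, ← T.cfe.ap, ← T.cff.ap, a, b, c]; simp
    · intro hb
      have : v ∈ W := (hW v).2 ⟨⟨hn, he2⟩, hf2⟩
      rw [hb] at this
      exact hv (by simpa using this)
  have hall : ∀ w, (h2 w = 0 ∧ e2 w = 0) ∧ f2 w = 0 := fun w => by
    rw [← hW, hWtop]; trivial
  obtain ⟨kh, ke, m', hm', hfm, hne⟩ := hw_string h1 e1 f1 T.hf1 T.ef1 v hv he1 m hm
  obtain rfl : m = m' := by exact_mod_cast hm'
  let U : Submodule ℂ V := Submodule.span ℂ (Set.range (fun i : Fin (m+1) => (f1 ^ (i:ℕ)) v))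
  have hU : ∀ k : ℕ, (f1 ^ k) v ∈ U := by
    intro k
    by_cases hk : k < m + 1
    · exact Submodule.subset_span ⟨⟨k, hk⟩, rfl⟩
    · obtain ⟨j, rfl⟩ := Nat.exists_eq_add_of_le' (not_lt.1 hk)
      rw [pow_add, Module.End.mul_apply, hfm, map_zero]
      exact U.zero_mem
  have hUtop : U = ⊤ := by
    refine (hirr U ?_).resolve_left ?_
    · intro w hw
      rw [(hall w).1.1, (hall w).1.2, (hall w).2]
      have key : ∀ g : Module.End ℂ V, (∀ k : ℕ, g ((f1 ^ k) v) ∈ U) → ∀ w ∈ U, g w ∈ U := by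
        intro g hg w hw
        have : U ≤ U.comap g := Submodule.span_le.2 (by rintro _ ⟨i, rfl⟩; exact hg i)
        exact this hw
      refine ⟨key _ ?_ w hw, key _ ?_ w hw, key _ ?_ w hw, U.zero_mem, U.zero_mem, U.zero_mem⟩
      · intro k; rw [kh]; exact U.smul_mem _ (hU k)
      · intro k
        cases k with
        | zero => simp [he1]
        | succ k => rw [ke]; exact U.smul_mem _ (hU k)
      · intro k
        rw [← Module.End.mul_apply, ← pow_succ']; exact hU _
    · intro hb
      have := hU 0
      rw [hb] at this
      exact hv (by simpa using this)
  have hcard : Module.finrank ℂ V ≤ m + 1 := by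
    have := finrank_range_le_card (R := ℂ) (fun i : Fin (m+1) => (f1 ^ (i:ℕ)) v)
    rw [Set.finrank] at this
    change Module.finrank ℂ U ≤ _ at this
    rw [hUtop, finrank_top] at this
    simpa using this
  obtain rfl : m = 3 := by omega
  refine ⟨LinearMap.ext fun w => (hall w).1.1, LinearMap.ext fun w => (hall w).1.2,
    LinearMap.ext fun w => (hall w).2, fun i => (f1 ^ (i:ℕ)) v, ?_, ?_⟩
  · refine Module.End.eigenvectors_linearIndependent' h1 (fun i : Fin 4 => ((3:ℕ):ℂ) - 2 * (i:ℕ))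
      ?_ _ (fun i => ⟨Module.End.mem_eigenspace_iff.2 (kh i), hne i (by omega)⟩)
    intro i j hij
    have : ((i:ℕ):ℂ) = (j:ℕ) := by
      simp only at hij
      linear_combination (-1/2) * hij
    exact Fin.ext (by exact_mod_cast this)
  · have a0 := kh 0
    have a1 := kh 1
    have a2 := kh 2
    have a3 := kh 3
    have b0 := ke 0
    have b1 := ke 1
    have b2 := ke 2
    norm_num at a0 a1 a2 a3 b0 b1 b2
    have c0 : ∀ k : ℕ, f1 ((f1 ^ k) v) = (f1 ^ (k+1)) v := fun k => by
      rw [← Module.End.mul_apply, ← pow_succ']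
    have c3 := c0 3
    rw [hfm] at c3
    refine ⟨?_, ?_, ?_, ?_, ?_, ?_, ?_, ?_, ?_, ?_, ?_, ?_⟩
    · simpa using a0
    · simpa using a1
    · simpa using a2
    · simpa using a3
    · simpa using he1
    · simpa using b0
    · simpa using b1
    · simpa using b2
    · simp
    · simpa using c0 1
    · simpa using c0 2
    · simpa using c3

end Sl2Tools

end

section

section Triples

open Matrix

local notation "M2" => Matrix (Fin 2) (Fin 2) ℂ
local notation "M4" => Matrix (Fin 4) (Fin 4) ℂ

/-- standard traceless matrix -/
def tlm (a b c : ℂ) : Matrix (Fin 2) (Fin 2) ℂ := !![a, b; c, -a]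

/-- standard traceless matrix, as an element of the kernel of trace -/
def tl (a b c : ℂ) : LinearMap.ker (Matrix.traceLinearMap (Fin 2) ℝ ℂ) :=
  ⟨tlm a b c, by
    change Matrix.trace (tlm a b c) = 0
    simp [tlm, Matrix.trace_fin_two]⟩

lemma pair_split (x x' y y' z z' : M4) (h1 : x * y - y * x = z) (h2 : x * y' - y' * x = z')
    (h3 : x' * y - y * x' = z') (h4 : x' * y' - y' * x' = -z) :
    ((1/2:ℂ) • (x - Complex.I • x')) * ((1/2:ℂ) • (y - Complex.I • y')) -
      ((1/2:ℂ) • (y - Complex.I • y')) * ((1/2:ℂ) • (x - Complex.I • x')) =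
      (1/2:ℂ) • (z - Complex.I • z') ∧
    ((1/2:ℂ) • (x + Complex.I • x')) * ((1/2:ℂ) • (y + Complex.I • y')) -
      ((1/2:ℂ) • (y + Complex.I • y')) * ((1/2:ℂ) • (x + Complex.I • x')) =
      (1/2:ℂ) • (z + Complex.I • z') ∧
    ((1/2:ℂ) • (x - Complex.I • x')) * ((1/2:ℂ) • (y + Complex.I • y')) =
      ((1/2:ℂ) • (y + Complex.I • y')) * ((1/2:ℂ) • (x - Complex.I • x')) ∧
    ((1/2:ℂ) • (y - Complex.I • y')) * ((1/2:ℂ) • (x + Complex.I • x')) =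
      ((1/2:ℂ) • (x + Complex.I • x')) * ((1/2:ℂ) • (y - Complex.I • y')) := by
  have e1 : x * y = z + y * x := by rw [← h1]; abel
  have e2 : x * y' = z' + y' * x := by rw [← h2]; abel
  have e3 : x' * y = z' + y * x' := by rw [← h3]; abel
  have e4 : x' * y' = -z + y' * x' := by rw [← h4]; abel
  have hI : Complex.I ^ 2 = -1 := Complex.I_sq
  refine ⟨?_, ?_, ?_, ?_⟩ <;>
  · simp only [smul_mul_assoc, mul_smul_comm, sub_mul, mul_sub, add_mul, mul_add, e1, e2, e3, e4,
      smul_add, smul_sub, smul_neg, smul_smul]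
    match_scalars <;> ring_nf <;> simp only [hI] <;> ring_nf

lemma exists_triples (ρ : Matrix.SpecialLinearGroup (Fin 2) ℂ →* Matrix.SpecialLinearGroup (Fin 4) ℂ)
    (hρ : Continuous ρ) :
    ∃ h1 e1 f1 h2 e2 f2 : M4,
      PairTriple (toLinAlgEquiv' h1) (toLinAlgEquiv' e1) (toLinAlgEquiv' f1)
        (toLinAlgEquiv' h2) (toLinAlgEquiv' e2) (toLinAlgEquiv' f2) ∧
      ∀ a b c : ℂ, ∀ g : Matrix.SpecialLinearGroup (Fin 2) ℂ, (g : M2) = mexp (tlm a b c) →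
        (ρ g : M4) = mexp (a • h1 + b • e1 + c • f1 +
          (star a • h2 + star b • e2 + star c • f2)) := by
  obtain ⟨φ, hφ, hbr⟩ := exists_diff ρ hρ
  have hB : ∀ a b c a' b' c' : ℂ, φ (tl a b c) * φ (tl a' b' c') - φ (tl a' b' c') * φ (tl a b c) =
      φ (tl (b * c' - b' * c) (2 * (a * b' - a' * b)) (2 * (a' * c - a * c'))) := by
    intro a b c a' b' c'
    refine (hbr _ _ _ ?_).symm
    simp only [tl, tlm]
    ext i j
    fin_cases i <;> fin_cases j <;> simp [Matrix.mul_apply, Fin.sum_univ_two] <;> ring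
  have hlin : ∀ (r : ℝ) (a b c : ℂ), φ (tl (r * a) (r * b) (r * c)) = (r:ℂ) • φ (tl a b c) := by
    intro r a b c
    have : tl (r * a) (r * b) (r * c) = r • tl a b c := by
      apply Subtype.ext
      change tlm _ _ _ = r • tlm _ _ _
      ext i j
      fin_cases i <;> fin_cases j <;> simp [tlm]
    rw [this, map_smul]
    ext i j; simp
  have hadd : ∀ a b c a' b' c' : ℂ, φ (tl (a + a') (b + b') (c + c')) =
      φ (tl a b c) + φ (tl a' b' c') := by
    intro a b c a' b' c'
    rw [← map_add]
    congr 1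
    apply Subtype.ext
    change tlm _ _ _ = tlm _ _ _ + tlm _ _ _
    ext i j
    fin_cases i <;> fin_cases j <;> simp [tlm]; ring
  have h2 := hlin 2
  have hm2 := hlin (-2)
  have hm1 := hlin (-1)
  have h0 := hlin 0 0 0 0
  obtain ⟨a1, a2, a3, a4⟩ := pair_split (φ (tl 1 0 0)) (φ (tl Complex.I 0 0)) (φ (tl 0 1 0))
    (φ (tl 0 Complex.I 0)) ((2:ℂ) • φ (tl 0 1 0)) ((2:ℂ) • φ (tl 0 Complex.I 0))
    (by rw [hB]; simpa using h2 0 1 0) (by rw [hB]; simpa using h2 0 Complex.I 0)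
    (by rw [hB]; simpa using h2 0 Complex.I 0) (by rw [hB]; simpa using hm2 0 1 0)
  obtain ⟨b1, b2, b3, b4⟩ := pair_split (φ (tl 1 0 0)) (φ (tl Complex.I 0 0)) (φ (tl 0 0 1))
    (φ (tl 0 0 Complex.I)) ((-2:ℂ) • φ (tl 0 0 1)) ((-2:ℂ) • φ (tl 0 0 Complex.I))
    (by rw [hB]; simpa using hm2 0 0 1) (by rw [hB]; simpa using hm2 0 0 Complex.I)
    (by rw [hB]; simpa using hm2 0 0 Complex.I) (by rw [hB]; simpa using h2 0 0 1)
  obtain ⟨c1, c2, c3, c4⟩ := pair_split (φ (tl 0 1 0)) (φ (tl 0 Complex.I 0)) (φ (tl 0 0 1))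
    (φ (tl 0 0 Complex.I)) (φ (tl 1 0 0)) (φ (tl Complex.I 0 0))
    (by rw [hB]; simp) (by rw [hB]; simp)
    (by rw [hB]; simp) (by rw [hB]; simpa using hm1 1 0 0)
  obtain ⟨-, -, d3, -⟩ := pair_split (φ (tl 1 0 0)) (φ (tl Complex.I 0 0)) (φ (tl 1 0 0))
    (φ (tl Complex.I 0 0)) 0 0
    (by rw [hB]; simpa using h0) (by rw [hB]; simpa using h0)
    (by rw [hB]; simpa using h0) (by rw [hB]; simpa using h0)
  obtain ⟨-, -, d4, -⟩ := pair_split (φ (tl 0 1 0)) (φ (tl 0 Complex.I 0)) (φ (tl 0 1 0))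
    (φ (tl 0 Complex.I 0)) 0 0
    (by rw [hB]; simpa using h0) (by rw [hB]; simpa using h0)
    (by rw [hB]; simpa using h0) (by rw [hB]; simpa using h0)
  obtain ⟨-, -, d5, -⟩ := pair_split (φ (tl 0 0 1)) (φ (tl 0 0 Complex.I)) (φ (tl 0 0 1))
    (φ (tl 0 0 Complex.I)) 0 0
    (by rw [hB]; simpa using h0) (by rw [hB]; simpa using h0)
    (by rw [hB]; simpa using h0) (by rw [hB]; simpa using h0)
  have hdec : ∀ a : ℂ, ∀ x x' : M4, (a.re:ℂ) • x + (a.im:ℂ) • x' =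
      a • ((1/2:ℂ) • (x - Complex.I • x')) + star a • ((1/2:ℂ) • (x + Complex.I • x')) := by
    intro a x x'
    have h1 : a = a.re + a.im * Complex.I := (Complex.re_add_im a).symm
    have h2 : star a = a.re - a.im * Complex.I := by
      apply Complex.ext <;> simp
    have hI : Complex.I ^ 2 = -1 := Complex.I_sq
    rw [h2]
    nth_rewrite 3 [h1]
    match_scalars <;> ring_nf
    simp only [hI]; ring_nf
  have key : ∀ u v : M4, ∀ w : M4, u * v - v * u = w →
      toLinAlgEquiv' u * toLinAlgEquiv' v - toLinAlgEquiv' v * toLinAlgEquiv' u =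
        (toLinAlgEquiv' w : Module.End ℂ (Fin 4 → ℂ)) := by
    intro u v w h
    rw [← h, map_sub, map_mul, map_mul]
  have key' : ∀ u v w x : M4, ∀ c : ℂ, u * v - v * u = w → w = c • x →
      toLinAlgEquiv' u * toLinAlgEquiv' v - toLinAlgEquiv' v * toLinAlgEquiv' u =
        (c • toLinAlgEquiv' x : Module.End ℂ (Fin 4 → ℂ)) := by
    intro u v w x c h h'
    rw [key _ _ _ h, h', map_smul]
  have key2 : ∀ u v : M4, u * v = v * u →
      Commute (toLinAlgEquiv' u : Module.End ℂ (Fin 4 → ℂ)) (toLinAlgEquiv' v) := by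
    intro u v h
    rw [commute_iff_eq, ← map_mul, h, map_mul]
  refine ⟨(1/2:ℂ) • (φ (tl 1 0 0) - Complex.I • φ (tl Complex.I 0 0)),
    (1/2:ℂ) • (φ (tl 0 1 0) - Complex.I • φ (tl 0 Complex.I 0)),
    (1/2:ℂ) • (φ (tl 0 0 1) - Complex.I • φ (tl 0 0 Complex.I)),
    (1/2:ℂ) • (φ (tl 1 0 0) + Complex.I • φ (tl Complex.I 0 0)),
    (1/2:ℂ) • (φ (tl 0 1 0) + Complex.I • φ (tl 0 Complex.I 0)),
    (1/2:ℂ) • (φ (tl 0 0 1) + Complex.I • φ (tl 0 0 Complex.I)), ?_, ?_⟩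
  · refine ⟨?_, ?_, key _ _ _ c1, ?_, ?_, key _ _ _ c2, key2 _ _ d3, key2 _ _ a3, key2 _ _ b3,
      key2 _ _ a4, key2 _ _ d4, key2 _ _ c3, key2 _ _ b4, key2 _ _ c4, key2 _ _ d5⟩
    · exact key' _ _ _ _ _ a1 (by module)
    · exact key' _ _ _ _ _ b1 (by module)
    · exact key' _ _ _ _ _ a2 (by module)
    · exact key' _ _ _ _ _ b2 (by module)
  · intro a b c g hg
    rw [hφ (tl a b c) g hg]
    congr 1
    have e1 : φ (tl a b c) = φ (tl a 0 0) + φ (tl 0 b 0) + φ (tl 0 0 c) := by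
      rw [← hadd, ← hadd]; simp
    have e2 : φ (tl a 0 0) = (a.re:ℂ) • φ (tl 1 0 0) + (a.im:ℂ) • φ (tl Complex.I 0 0) := by
      rw [← hlin, ← hlin, ← hadd]; simp [Complex.re_add_im]
    have e3 : φ (tl 0 b 0) = (b.re:ℂ) • φ (tl 0 1 0) + (b.im:ℂ) • φ (tl 0 Complex.I 0) := by
      rw [← hlin, ← hlin, ← hadd]; simp [Complex.re_add_im]
    have e4 : φ (tl 0 0 c) = (c.re:ℂ) • φ (tl 0 0 1) + (c.im:ℂ) • φ (tl 0 0 Complex.I) := by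
      rw [← hlin, ← hlin, ← hadd]; simp [Complex.re_add_im]
    rw [e1, e2, e3, e4, hdec, hdec, hdec]
    abel

/-- `SL(2)` is generated by unipotents, hence by exponentials -/
lemma sl2_gen (N : Submonoid (Matrix.SpecialLinearGroup (Fin 2) ℂ))
    (hN : ∀ a b c : ℂ, ∀ g : Matrix.SpecialLinearGroup (Fin 2) ℂ,
      (g : M2) = mexp (tlm a b c) → g ∈ N) (g : Matrix.SpecialLinearGroup (Fin 2) ℂ) : g ∈ N := by
  have hU : ∀ x : ℂ, ∀ u : Matrix.SpecialLinearGroup (Fin 2) ℂ, (u : M2) = !![1, x; 0, 1] → u ∈ N := by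
    intro x u hu
    refine hN 0 x 0 u ?_
    rw [hu, mexp_sq_zero _ (by ext i j; fin_cases i <;> fin_cases j <;> simp [tlm])]
    ext i j; fin_cases i <;> fin_cases j <;> simp [tlm]
  have hL : ∀ x : ℂ, ∀ u : Matrix.SpecialLinearGroup (Fin 2) ℂ, (u : M2) = !![1, 0; x, 1] → u ∈ N := by
    intro x u hu
    refine hN 0 0 x u ?_
    rw [hu, mexp_sq_zero _ (by ext i j; fin_cases i <;> fin_cases j <;> simp [tlm])]
    ext i j; fin_cases i <;> fin_cases j <;> simp [tlm]
  have main : ∀ g : Matrix.SpecialLinearGroup (Fin 2) ℂ, (g : M2) 1 0 ≠ 0 → g ∈ N := by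
    intro g hg
    have hd := g.2
    rw [Matrix.det_fin_two] at hd
    let u1 : Matrix.SpecialLinearGroup (Fin 2) ℂ :=
      ⟨!![1, ((g : M2) 0 0 - 1) / (g : M2) 1 0; 0, 1], by simp⟩
    let u2 : Matrix.SpecialLinearGroup (Fin 2) ℂ := ⟨!![1, 0; (g : M2) 1 0, 1], by simp⟩
    let u3 : Matrix.SpecialLinearGroup (Fin 2) ℂ :=
      ⟨!![1, ((g : M2) 1 1 - 1) / (g : M2) 1 0; 0, 1], by simp⟩
    have : g = u1 * u2 * u3 := by
      apply Subtype.ext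
      change (g : M2) = !![1, ((g : M2) 0 0 - 1) / (g : M2) 1 0; 0, 1] *
        !![1, 0; (g : M2) 1 0, 1] * !![1, ((g : M2) 1 1 - 1) / (g : M2) 1 0; 0, 1]
      ext i j
      fin_cases i <;> fin_cases j <;> simp [Matrix.mul_apply, Fin.sum_univ_two] <;> field_simp <;>
        first
        | linear_combination hd
        | linear_combination (-1:ℂ) * hd
        | linear_combination (0:ℂ) * hd
    rw [this]
    exact N.mul_mem (N.mul_mem (hU _ _ rfl) (hL _ _ rfl)) (hU _ _ rfl)
  by_cases hg : (g : M2) 1 0 = 0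
  · let u : Matrix.SpecialLinearGroup (Fin 2) ℂ := ⟨!![1, 0; 1, 1], by simp⟩
    let u' : Matrix.SpecialLinearGroup (Fin 2) ℂ := ⟨!![1, 0; -1, 1], by simp⟩
    have hd := g.2
    rw [Matrix.det_fin_two, hg, mul_zero, sub_zero] at hd
    have h0 : (g : M2) 0 0 ≠ 0 := left_ne_zero_of_mul_eq_one hd
    have hm := main (u * g) (by
      change ((!![1, 0; 1, 1] : M2) * (g : M2)) 1 0 ≠ 0
      simpa [Matrix.mul_apply, Fin.sum_univ_two, hg] using h0)
    have : g = u' * (u * g) := by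
      rw [← mul_assoc]
      have : u' * u = 1 := by
        apply Subtype.ext
        change (!![1, 0; -1, 1] : M2) * !![1, 0; 1, 1] = 1
        ext i j
        fin_cases i <;> fin_cases j <;> simp
      rw [this, one_mul]
    rw [this]
    exact N.mul_mem (hL _ _ rfl) hm
  · exact main g hg

end Triples

end

section

section Standard

open Matrix

local notation "M2" => Matrix (Fin 2) (Fin 2) ℂ
local notation "M4" => Matrix (Fin 4) (Fin 4) ℂ

/-- the diagonal generator -/
def h0 : Matrix (Fin 4) (Fin 4) ℂ := !![3, 0, 0, 0; 0, 1, 0, 0; 0, 0, -1, 0; 0, 0, 0, -3]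
/-- the raising generator -/
def e0 : Matrix (Fin 4) (Fin 4) ℂ := !![0, 3, 0, 0; 0, 0, 4, 0; 0, 0, 0, 3; 0, 0, 0, 0]
/-- the lowering generator -/
def f0 : Matrix (Fin 4) (Fin 4) ℂ := !![0, 0, 0, 0; 1, 0, 0, 0; 0, 1, 0, 0; 0, 0, 1, 0]

lemma basis_to_matrix (h e f : M4) (x : Fin 4 → (Fin 4 → ℂ)) (hx : LinearIndependent ℂ x)
    (hh : h.mulVec (x 0) = (3:ℂ) • x 0 ∧ h.mulVec (x 1) = x 1 ∧ h.mulVec (x 2) = -x 2 ∧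
      h.mulVec (x 3) = (-3:ℂ) • x 3)
    (he : e.mulVec (x 0) = 0 ∧ e.mulVec (x 1) = (3:ℂ) • x 0 ∧ e.mulVec (x 2) = (4:ℂ) • x 1 ∧
      e.mulVec (x 3) = (3:ℂ) • x 2)
    (hf : f.mulVec (x 0) = x 1 ∧ f.mulVec (x 1) = x 2 ∧ f.mulVec (x 2) = x 3 ∧
      f.mulVec (x 3) = 0) :
    ∃ P Q : M4, P * Q = 1 ∧ Q * P = 1 ∧ h = P * h0 * Q ∧ e = P * e0 * Q ∧ f = P * f0 * Q := by
  let P : M4 := (Matrix.of x)ᵀ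
  have hP : IsUnit P := by
    rw [← Matrix.linearIndependent_cols_iff_isUnit]
    exact hx
  obtain ⟨u, hu⟩ := hP
  have h1 : P * (u⁻¹ : M4ˣ) = 1 := by rw [← hu]; simp
  have h2 : (u⁻¹ : M4ˣ) * P = 1 := by rw [← hu]; simp
  have key : ∀ a b : M4, a * P = P * b → a = P * b * (u⁻¹ : M4ˣ) := by
    intro a b hab
    rw [← hab, mul_assoc, h1, mul_one]
  have col : ∀ a : M4, ∀ i j, (a * P) i j = (a.mulVec (x j)) i := by
    intro a i j; rfl
  have hPij : ∀ i j, P i j = x j i := fun i j => rfl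
  obtain ⟨a0, a1, a2, a3⟩ := hh
  obtain ⟨b0, b1, b2, b3⟩ := he
  obtain ⟨c0, c1, c2, c3⟩ := hf
  refine ⟨P, (u⁻¹ : M4ˣ), h1, h2, key _ _ ?_, key _ _ ?_, key _ _ ?_⟩ <;>
  · ext i j
    rw [col, Matrix.mul_apply, Fin.sum_univ_four]
    simp only [hPij]
    fin_cases j <;> simp [a0, a1, a2, a3, b0, b1, b2, b3, c0, c1, c2, c3, h0, e0, f0, mul_comm]

lemma exists_std (ρ : Matrix.SpecialLinearGroup (Fin 2) ℂ →* Matrix.SpecialLinearGroup (Fin 4) ℂ)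
    (hρcont : Continuous ρ) (hρinj : Function.Injective ρ)
    (hirr : ∀ W : Submodule ℂ (Fin 4 → ℂ),
      (∀ g : Matrix.SpecialLinearGroup (Fin 2) ℂ, ∀ w ∈ W,
        ((ρ g : Matrix (Fin 4) (Fin 4) ℂ)).mulVec w ∈ W) → W = ⊥ ∨ W = ⊤) :
    ∃ P Q : M4, P * Q = 1 ∧ Q * P = 1 ∧
      ∀ a b c : ℂ, mexp (P * (a • h0 + b • e0 + c • f0) * Q) ∈ subM ρ.range := by
  obtain ⟨h1, e1, f1, h2, e2, f2, T, hexp⟩ := exists_triples ρ hρcont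
  have hirr' : ∀ W : Submodule ℂ (Fin 4 → ℂ), (∀ w ∈ W, toLinAlgEquiv' h1 w ∈ W ∧
      toLinAlgEquiv' e1 w ∈ W ∧ toLinAlgEquiv' f1 w ∈ W ∧ toLinAlgEquiv' h2 w ∈ W ∧
      toLinAlgEquiv' e2 w ∈ W ∧ toLinAlgEquiv' f2 w ∈ W) → W = ⊥ ∨ W = ⊤ := by
    intro W hW
    refine hirr W fun g => ?_
    let p : Submodule ℝ M4 :=
      { carrier := {A | ∀ w ∈ W, A.mulVec w ∈ W}
        zero_mem' := fun w hw => by simp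
        add_mem' := fun {A B} hA hB w hw => by
          rw [Matrix.add_mulVec]; exact W.add_mem (hA w hw) (hB w hw)
        smul_mem' := fun r A hA w hw => by
          have : r • A = (r:ℂ) • A := by ext i j; simp
          rw [this, Matrix.smul_mulVec]; exact W.smul_mem _ (hA w hw) }
    let N : Submonoid (Matrix.SpecialLinearGroup (Fin 2) ℂ) :=
      { carrier := {g | ∀ w ∈ W, (ρ g : M4).mulVec w ∈ W}
        one_mem' := fun w hw => by simpa using hw
        mul_mem' := fun {a b} ha hb w hw => by
          have : (ρ (a * b) : M4) = (ρ a : M4) * (ρ b : M4) := by rw [map_mul]; rfl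
          rw [this, ← Matrix.mulVec_mulVec]
          exact ha _ (hb w hw) }
    refine sl2_gen N ?_ g
    intro a b c g hg
    change ∀ w ∈ W, (ρ g : M4).mulVec w ∈ W
    rw [hexp a b c g hg]
    refine mexp_mem p _ fun k => ?_
    have hX : ∀ w ∈ W, (a • h1 + b • e1 + c • f1 +
          (star a • h2 + star b • e2 + star c • f2)).mulVec w ∈ W := by
      intro w hw
      obtain ⟨q1, q2, q3, q4, q5, q6⟩ := hW w hw
      simp only [toLinAlgEquiv'_apply] at q1 q2 q3 q4 q5 q6
      simp only [Matrix.add_mulVec, Matrix.smul_mulVec]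
      exact W.add_mem (W.add_mem (W.add_mem (W.smul_mem _ q1) (W.smul_mem _ q2)) (W.smul_mem _ q3))
        (W.add_mem (W.add_mem (W.smul_mem _ q4) (W.smul_mem _ q5)) (W.smul_mem _ q6))
    change ∀ w ∈ W, (_ ^ k : M4).mulVec w ∈ W
    induction k with
    | zero => intro w hw; simpa using hw
    | succ k ih =>
      intro w hw
      rw [pow_succ, ← Matrix.mulVec_mulVec]
      exact ih _ (hX w hw)
  -- the central element
  let z : Matrix.SpecialLinearGroup (Fin 2) ℂ := ⟨-1, by simp [Matrix.det_fin_two]⟩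
  have hz : (z : M2) = mexp (tlm (Real.pi * Complex.I) 0 0) := by
    have : tlm (Real.pi * Complex.I) 0 0 =
        Matrix.diagonal ![Real.pi * Complex.I, -(Real.pi * Complex.I)] := by
      ext i j; fin_cases i <;> fin_cases j <;> simp [tlm]
    rw [this, mexp_diagonal]
    change (-1 : M2) = _
    ext i j; fin_cases i <;> fin_cases j <;> simp [Complex.exp_neg]
  have hzz : z * z = 1 := by
    apply Subtype.ext
    change (-1 : M2) * (-1) = 1
    simp
  have hzc : ∀ g, g * z = z * g := by
    intro g
    apply Subtype.ext
    change (g : M2) * (-1) = (-1) * (g : M2)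
    simp
  have hz1 : z ≠ 1 := by
    intro h
    have : (-1 : M2) = 1 := congrArg Subtype.val h
    have := congrFun (congrFun this 0) 0
    norm_num at this
  have hρz : ∀ w, (ρ z : M4).mulVec w = -w := by
    have hzz' : ∀ w, (ρ z : M4).mulVec ((ρ z : M4).mulVec w) = w := by
      intro w
      have : (ρ z : M4) * (ρ z : M4) = 1 := by
        have : ρ z * ρ z = 1 := by rw [← map_mul, hzz, map_one]
        exact congrArg Subtype.val this
      rw [Matrix.mulVec_mulVec, this, Matrix.one_mulVec]
    let W : Submodule ℂ (Fin 4 → ℂ) := LinearMap.ker (Matrix.toLin' ((ρ z : M4) + 1))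
    have hW : ∀ w, w ∈ W ↔ (ρ z : M4).mulVec w = -w := by
      intro w
      simp only [W, LinearMap.mem_ker, Matrix.toLin'_apply, Matrix.add_mulVec, Matrix.one_mulVec]
      exact add_eq_zero_iff_eq_neg
    have hWt : W = ⊤ := by
      refine (hirr W ?_).resolve_left ?_
      · intro g w hw
        rw [hW] at hw ⊢
        have : (ρ z : M4) * (ρ g : M4) = (ρ g : M4) * (ρ z : M4) := by
          have : ρ z * ρ g = ρ g * ρ z := by rw [← map_mul, ← map_mul, hzc]
          exact congrArg Subtype.val this
        rw [Matrix.mulVec_mulVec, this, ← Matrix.mulVec_mulVec, hw, Matrix.mulVec_neg]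
      · intro hb
        refine hz1 (hρinj ?_)
        rw [map_one]
        apply Subtype.ext
        change (ρ z : M4) = 1
        apply Matrix.toLin'.injective
        apply LinearMap.ext
        intro u
        rw [Matrix.toLin'_one, Matrix.toLin'_apply, LinearMap.id_apply]
        have : (ρ z : M4).mulVec u - u ∈ W := by
          rw [hW, Matrix.mulVec_sub, hzz']; abel
        rw [hb] at this
        exact sub_eq_zero.1 (by simpa using this)
    intro w
    rw [← hW, hWt]; trivial
  obtain ⟨v, hv, hev1, hev2, a, b, ha, hb⟩ := pair_hw T
  obtain ⟨-, -, m, rfl, -, -⟩ := hw_string _ _ _ T.hf1 T.ef1 v hv hev1 a ha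
  obtain ⟨-, -, n, rfl, -, -⟩ := hw_string _ _ _ T.hf2 T.ef2 v hv hev2 b hb
  have hdim : Module.finrank ℂ (Fin 4 → ℂ) = 4 := by simp
  have hle := pair_dim T v hv hev1 hev2 m n ha hb
  rw [hdim] at hle
  have hne : m ≠ n := by
    rintro rfl
    have g1 := hexp (Real.pi * Complex.I) 0 0 z hz
    have g2 := mexp_eigen _ v 0 (show (((Real.pi * Complex.I : ℂ) • h1 + (0:ℂ) • e1 + (0:ℂ) • f1 +
          (star (Real.pi * Complex.I : ℂ) • h2 + star (0:ℂ) • e2 + star (0:ℂ) • f2))).mulVec v =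
          (0:ℂ) • v by
      rw [toLinAlgEquiv'_apply] at ha hb
      simp only [Matrix.add_mulVec, Matrix.smul_mulVec, ha, hb]
      simp)
    rw [← g1, hρz] at g2
    simp at g2
    have h3 : (2:ℂ) • v = 0 := by rw [two_smul]; nth_rewrite 1 [← g2]; simp
    exact hv ((smul_eq_zero.1 h3).resolve_left (by norm_num))
  have hcase : m = 0 ∨ n = 0 := by
    rcases m with _ | m
    · simp
    rcases n with _ | n
    · simp
    exfalso
    rcases m with _ | m
    · rcases n with _ | n
      · exact hne rfl
      · nlinarith
    · nlinarith
  have mem : ∀ a b c : ℂ, mexp (a • h1 + b • e1 + c • f1 +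
          (star a • h2 + star b • e2 + star c • f2)) ∈ subM ρ.range := by
    intro a b c
    let g : Matrix.SpecialLinearGroup (Fin 2) ℂ := ⟨mexp (tlm a b c), det_mexp (by
      simp [tlm, Matrix.trace_fin_two])⟩
    rw [← hexp a b c g rfl]
    exact coe_mem_subM.2 ⟨g, rfl⟩
  have inj : ∀ A : M4, toLinAlgEquiv' A = (0 : Module.End ℂ (Fin 4 → ℂ)) → A = 0 := by
    intro A hA
    exact toLinAlgEquiv'.injective (by rw [hA, map_zero])
  rcases hcase with rfl | rfl
  · have T' : PairTriple (toLinAlgEquiv' h2) (toLinAlgEquiv' e2) (toLinAlgEquiv' f2)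
        (toLinAlgEquiv' h1) (toLinAlgEquiv' e1) (toLinAlgEquiv' f1) :=
      ⟨T.he2, T.hf2, T.ef2, T.he1, T.hf1, T.ef1, T.chh.symm, T.ceh.symm, T.cfh.symm, T.che.symm,
        T.cee.symm, T.cfe.symm, T.chf.symm, T.cef.symm, T.cff.symm⟩
    obtain ⟨z1, z2, z3, x, hx, q1, q2, q3, q4, q5, q6, q7, q8, q9, q10, q11, q12⟩ :=
      pair_zero T' (fun W hW => hirr' W fun w hw => by
        obtain ⟨a, b, c, d, e, f⟩ := hW w hw
        exact ⟨d, e, f, a, b, c⟩) hdim v hv hev2 hev1 n hb (by simpa using ha)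
    obtain ⟨P, Q, hPQ, hQP, rh, re, rf⟩ := basis_to_matrix h2 e2 f2 x hx ⟨q1, q2, q3, q4⟩
      ⟨q5, q6, q7, q8⟩ ⟨q9, q10, q11, q12⟩
    refine ⟨P, Q, hPQ, hQP, fun a b c => ?_⟩
    have := mem (star a) (star b) (star c)
    rw [inj _ z1, inj _ z2, inj _ z3, rh, re, rf] at this
    convert this using 2
    simp [mul_add, add_mul]
  · obtain ⟨z1, z2, z3, x, hx, q1, q2, q3, q4, q5, q6, q7, q8, q9, q10, q11, q12⟩ :=
      pair_zero T hirr' hdim v hv hev1 hev2 m ha (by simpa using hb)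
    obtain ⟨P, Q, hPQ, hQP, rh, re, rf⟩ := basis_to_matrix h1 e1 f1 x hx ⟨q1, q2, q3, q4⟩
      ⟨q5, q6, q7, q8⟩ ⟨q9, q10, q11, q12⟩
    refine ⟨P, Q, hPQ, hQP, fun a b c => ?_⟩
    have := mem a b c
    rw [inj _ z1, inj _ z2, inj _ z3, rh, re, rf] at this
    convert this using 2
    simp [mul_add, add_mul]

end Standard

end

section

section Classify

open Matrix

local notation "M4" => Matrix (Fin 4) (Fin 4) ℂ

/-- the adjoint action -/
noncomputable def adE (A : Matrix (Fin 4) (Fin 4) ℂ) : Module.End ℂ (Matrix (Fin 4) (Fin 4) ℂ) :=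
  LinearMap.mulLeft ℂ A - LinearMap.mulRight ℂ A

lemma adE_apply (A X : M4) : adE A X = A * X - X * A := rfl

lemma adE_bracket (A B C : M4) (h : A * B - B * A = C) :
    adE A * adE B - adE B * adE A = adE C := by
  ext1 X
  simp only [LinearMap.sub_apply, Module.End.mul_apply, adE_apply, ← h]
  noncomm_ring

lemma adE_smul (c : ℂ) (A : M4) : adE (c • A) = c • adE A := by
  ext1 X
  simp only [adE_apply, LinearMap.smul_apply, smul_mul_assoc, mul_smul_comm, smul_sub]

lemma br_he : h0 * e0 - e0 * h0 = (2:ℂ) • e0 := by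
  ext i j; fin_cases i <;> fin_cases j <;> simp [h0, e0] <;> norm_num

lemma br_hf : h0 * f0 - f0 * h0 = (-2:ℂ) • f0 := by
  ext i j; fin_cases i <;> fin_cases j <;> simp [h0, f0] <;> norm_num

lemma br_ef : e0 * f0 - f0 * e0 = h0 := by
  ext i j; fin_cases i <;> fin_cases j <;> simp [h0, e0, f0] <;> norm_num

/-- string elements -/
noncomputable def wv (v : Matrix (Fin 4) (Fin 4) ℂ) (k : ℕ) : Matrix (Fin 4) (Fin 4) ℂ :=
  (adE f0 ^ k) v

lemma wv_zero (v : M4) : wv v 0 = v := by simp [wv]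

lemma wv_succ (v : M4) (k : ℕ) : wv v (k+1) = f0 * wv v k - wv v k * f0 := by
  rw [wv, pow_succ', Module.End.mul_apply, adE_apply]; rfl

/-- `v` is a highest weight vector of weight `n` -/
structure HW (v : Matrix (Fin 4) (Fin 4) ℂ) (n : ℕ) : Prop where
  hh : ∀ k : ℕ, adE h0 (wv v k) = ((n:ℂ) - 2 * k) • wv v k
  ez : adE e0 (wv v 0) = 0
  ee : ∀ k : ℕ, adE e0 (wv v (k+1)) = (((k:ℂ) + 1) * (n - k)) • wv v k
  ff : ∀ k : ℕ, adE f0 (wv v k) = wv v (k + 1)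
  nn : n ≠ 0

lemma hw_mk (v : M4) (n : ℕ) (hn : n ≠ 0) (hv : v ≠ 0) (he : e0 * v - v * e0 = 0)
    (hh : h0 * v - v * h0 = (n:ℂ) • v) : HW v n := by
  obtain ⟨a, b, -⟩ := hw_string (adE h0) (adE e0) (adE f0)
    (by rw [adE_bracket _ _ _ br_hf, adE_smul]) (adE_bracket _ _ _ br_ef) v hv he n hh
  exact ⟨a, by rw [wv_zero]; exact he, b,
    fun k => by rw [wv, wv, pow_succ', Module.End.mul_apply], hn⟩

/-- elements of the string space -/
noncomputable def us (v : Matrix (Fin 4) (Fin 4) ℂ) (n : ℕ) (c : ℕ → ℂ) :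
    Matrix (Fin 4) (Fin 4) ℂ := ∑ k ∈ Finset.range (n+1), c k • wv v k

/-- Casimir -/
noncomputable def Cas : Module.End ℂ (Matrix (Fin 4) (Fin 4) ℂ) :=
  adE e0 * adE f0 + adE f0 * adE e0 + (1/2:ℂ) • (adE h0 * adE h0)

lemma Cas_us {v : M4} {n : ℕ} (H : HW v n) (c : ℕ → ℂ) :
    Cas (us v n c) = ((n:ℂ) * (n + 2) / 2) • us v n c := by
  rw [us, map_sum, Finset.smul_sum]
  refine Finset.sum_congr rfl fun k _ => ?_
  rw [map_smul, smul_comm]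
  congr 1
  simp only [Cas, LinearMap.add_apply, Module.End.mul_apply, LinearMap.smul_apply, H.ff, H.ee,
    H.hh, map_smul]
  cases k with
  | zero =>
    rw [H.ez, map_zero]
    match_scalars; push_cast; ring
  | succ k =>
    rw [H.ee, map_smul, H.ff]
    match_scalars; push_cast; ring

/-- a real Lie subalgebra containing the standard one -/
structure SubAlg (𝔤 : Submodule ℝ (Matrix (Fin 4) (Fin 4) ℂ)) : Prop where
  br : ∀ X ∈ 𝔤, ∀ Y ∈ 𝔤, X * Y - Y * X ∈ 𝔤
  std : ∀ a b c : ℂ, a • h0 + b • e0 + c • f0 ∈ 𝔤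
  tr : ∀ X ∈ 𝔤, X.trace = 0

variable {𝔤 : Submodule ℝ (Matrix (Fin 4) (Fin 4) ℂ)}

lemma SubAlg.adh (G : SubAlg 𝔤) (z : ℂ) {X : M4} (hX : X ∈ 𝔤) : z • adE h0 X ∈ 𝔤 := by
  have := G.br _ (G.std z 0 0) _ hX
  simpa [adE_apply, smul_sub] using this

lemma SubAlg.ade (G : SubAlg 𝔤) (z : ℂ) {X : M4} (hX : X ∈ 𝔤) : z • adE e0 X ∈ 𝔤 := by
  have := G.br _ (G.std 0 z 0) _ hX
  simpa [adE_apply, smul_sub] using this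

lemma SubAlg.adf (G : SubAlg 𝔤) (z : ℂ) {X : M4} (hX : X ∈ 𝔤) : z • adE f0 X ∈ 𝔤 := by
  have := G.br _ (G.std 0 0 z) _ hX
  simpa [adE_apply, smul_sub] using this

lemma SubAlg.cas (G : SubAlg 𝔤) {X : M4} (hX : X ∈ 𝔤) : Cas X ∈ 𝔤 := by
  have e1 := fun {X} (h : X ∈ 𝔤) => G.ade 1 h
  have f1 := fun {X} (h : X ∈ 𝔤) => G.adf 1 h
  have h1 := fun {X} (h : X ∈ 𝔤) => G.adh 1 h
  simp only [one_smul] at e1 f1 h1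
  exact 𝔤.add_mem (𝔤.add_mem (e1 (f1 hX)) (f1 (e1 hX))) (G.adh (1/2) (h1 hX))

lemma SubAlg.all_of_hw (G : SubAlg 𝔤) {v : M4} {n : ℕ} (H : HW v n) {z : ℂ} (hz : z ≠ 0)
    (h : z • wv v 0 ∈ 𝔤) : ∀ c, us v n c ∈ 𝔤 := by
  have hn : (n:ℂ) ≠ 0 := by exact_mod_cast H.nn
  have h1 : ∀ k : ℕ, ∀ y : ℂ, y • wv v k ∈ 𝔤 := by
    intro k
    induction k with
    | zero =>
      intro y
      have := G.adh (y / (z * n)) h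
      rw [map_smul, H.hh] at this
      convert this using 1
      rw [smul_smul, smul_smul]
      congr 1
      field_simp
      simp
    | succ k ih =>
      intro y
      have := G.adf y (ih 1)
      rwa [one_smul, H.ff] at this
  intro c
  exact 𝔤.sum_mem fun k _ => h1 k _

lemma SubAlg.exists_hw (G : SubAlg 𝔤) {v : M4} {n : ℕ} (H : HW v n) : ∀ N ≤ n, ∀ c : ℕ → ℂ,
    (∃ k ≤ N, c k ≠ 0) → us v N c ∈ 𝔤 → ∃ z : ℂ, z ≠ 0 ∧ z • wv v 0 ∈ 𝔤 := by
  intro N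
  induction N with
  | zero =>
    rintro - c ⟨k, hk, hc⟩ h
    obtain rfl : k = 0 := by omega
    exact ⟨c 0, hc, by simpa [us] using h⟩
  | succ N ih =>
    rintro hN c ⟨k, hk, hc⟩ h
    by_cases hex : ∃ k ≤ N, c (k+1) ≠ 0
    · obtain ⟨j, hj, hcj⟩ := hex
      refine ih (by omega) (fun k => c (k+1) * (((k:ℂ) + 1) * (n - k))) ⟨j, hj, ?_⟩ ?_
      · refine mul_ne_zero hcj (mul_ne_zero (by exact_mod_cast Nat.succ_ne_zero j) ?_)
        rw [sub_ne_zero]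
        exact_mod_cast (show n ≠ j by omega)
      · have := G.ade 1 h
        rw [one_smul, us, Finset.sum_range_succ', map_add, map_smul, H.ez, smul_zero, add_zero,
          map_sum] at this
        convert this using 1
        rw [us]
        refine Finset.sum_congr rfl fun k _ => ?_
        rw [map_smul, H.ee, smul_smul]
    · push Not at hex
      have hk0 : k = 0 := by
        by_contra hk0
        obtain ⟨j, rfl⟩ := Nat.exists_eq_succ_of_ne_zero hk0
        exact hc (hex j (by omega))
      subst hk0
      refine ⟨c 0, hc, ?_⟩
      rw [us, Finset.sum_range_succ', Finset.sum_eq_zero, zero_add] at h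
      · exact h
      · intro k hk
        rw [hex k (by simpa [Nat.lt_succ_iff] using hk), zero_smul]

lemma SubAlg.dichotomy (G : SubAlg 𝔤) {v : M4} {n : ℕ} (H : HW v n) {c : ℕ → ℂ}
    (h : us v n c ∈ 𝔤) : us v n c = 0 ∨ ∀ c', us v n c' ∈ 𝔤 := by
  by_cases hex : ∃ k ≤ n, c k ≠ 0
  · obtain ⟨z, hz, hz'⟩ := G.exists_hw H n le_rfl c hex h
    exact Or.inr (G.all_of_hw H hz hz')
  · push Not at hex
    left
    rw [us]
    refine Finset.sum_eq_zero fun k hk => ?_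
    rw [hex k (by simpa [Nat.lt_succ_iff] using hk), zero_smul]

/-- explicit square of `e0` -/
def v4 : Matrix (Fin 4) (Fin 4) ℂ := !![0, 0, 12, 0; 0, 0, 0, 12; 0, 0, 0, 0; 0, 0, 0, 0]
/-- explicit cube of `e0` -/
def v6 : Matrix (Fin 4) (Fin 4) ℂ := !![0, 0, 0, 36; 0, 0, 0, 0; 0, 0, 0, 0; 0, 0, 0, 0]

lemma hw2 : HW e0 2 := by
  refine hw_mk _ _ (by norm_num) ?_ (by simp) (by simpa using br_he)
  intro h
  have := congrFun (congrFun h 0) 1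
  simp [e0] at this

lemma hw4 : HW v4 4 := by
  refine hw_mk _ _ (by norm_num) ?_ ?_ ?_
  · intro h
    have := congrFun (congrFun h 0) 2
    simp [v4] at this
  · ext i j; fin_cases i <;> fin_cases j <;> simp [v4, e0] <;> norm_num
  · ext i j; fin_cases i <;> fin_cases j <;> simp [v4, h0] <;> norm_num

lemma hw6 : HW v6 6 := by
  refine hw_mk _ _ (by norm_num) ?_ ?_ ?_
  · intro h
    have := congrFun (congrFun h 0) 3
    simp [v6] at this
  · ext i j; fin_cases i <;> fin_cases j <;> simp [v6, e0]
  · ext i j; fin_cases i <;> fin_cases j <;> simp [v6, h0] <;> norm_num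

lemma wstep {v A B : M4} {k : ℕ} (h : wv v k = A) (hB : f0 * A - A * f0 = B) :
    wv v (k+1) = B := by
  rw [wv_succ, h, hB]

lemma w2_1 : wv e0 1 = !![-3, 0, 0, 0; 0, -1, 0, 0; 0, 0, 1, 0; 0, 0, 0, 3] :=
  wstep (wv_zero _) (by
    ext i j; fin_cases i <;> fin_cases j <;> simp [e0, f0] <;> norm_num)
lemma w2_2 : wv e0 2 = !![0, 0, 0, 0; -2, 0, 0, 0; 0, -2, 0, 0; 0, 0, -2, 0] :=
  wstep w2_1 (by ext i j; fin_cases i <;> fin_cases j <;> simp [f0] <;> norm_num)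
lemma w4_1 : wv v4 1 = !![0, -12, 0, 0; 0, 0, 0, 0; 0, 0, 0, 12; 0, 0, 0, 0] :=
  wstep (wv_zero _) (by ext i j; fin_cases i <;> fin_cases j <;> simp [v4, f0])
lemma w4_2 : wv v4 2 = !![12, 0, 0, 0; 0, -12, 0, 0; 0, 0, -12, 0; 0, 0, 0, 12] :=
  wstep w4_1 (by ext i j; fin_cases i <;> fin_cases j <;> simp [f0])
lemma w4_3 : wv v4 3 = !![0, 0, 0, 0; 24, 0, 0, 0; 0, 0, 0, 0; 0, 0, -24, 0] :=
  wstep w4_2 (by ext i j; fin_cases i <;> fin_cases j <;> simp [f0] <;> norm_num)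
lemma w4_4 : wv v4 4 = !![0, 0, 0, 0; 0, 0, 0, 0; 24, 0, 0, 0; 0, 24, 0, 0] :=
  wstep w4_3 (by ext i j; fin_cases i <;> fin_cases j <;> simp [f0])
lemma w6_1 : wv v6 1 = !![0, 0, -36, 0; 0, 0, 0, 36; 0, 0, 0, 0; 0, 0, 0, 0] :=
  wstep (wv_zero _) (by ext i j; fin_cases i <;> fin_cases j <;> simp [v6, f0])
lemma w6_2 : wv v6 2 = !![0, 36, 0, 0; 0, 0, -72, 0; 0, 0, 0, 36; 0, 0, 0, 0] :=
  wstep w6_1 (by ext i j; fin_cases i <;> fin_cases j <;> simp [f0] <;> norm_num)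
lemma w6_3 : wv v6 3 = !![-36, 0, 0, 0; 0, 108, 0, 0; 0, 0, -108, 0; 0, 0, 0, 36] :=
  wstep w6_2 (by ext i j; fin_cases i <;> fin_cases j <;> simp [f0] <;> norm_num)
lemma w6_4 : wv v6 4 = !![0, 0, 0, 0; -144, 0, 0, 0; 0, 216, 0, 0; 0, 0, -144, 0] :=
  wstep w6_3 (by ext i j; fin_cases i <;> fin_cases j <;> simp [f0] <;> norm_num)
lemma w6_5 : wv v6 5 = !![0, 0, 0, 0; 0, 0, 0, 0; -360, 0, 0, 0; 0, 360, 0, 0] :=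
  wstep w6_4 (by ext i j; fin_cases i <;> fin_cases j <;> simp [f0] <;> norm_num)
lemma w6_6 : wv v6 6 = !![0, 0, 0, 0; 0, 0, 0, 0; 0, 0, 0, 0; -720, 0, 0, 0] :=
  wstep w6_5 (by ext i j; fin_cases i <;> fin_cases j <;> simp [f0] <;> norm_num)

lemma us2 (c : ℕ → ℂ) : us e0 2 c = !![-3 * c 1, 3 * c 0, 0, 0; -2 * c 2, -c 1, 4 * c 0, 0;
    0, -2 * c 2, c 1, 3 * c 0; 0, 0, -2 * c 2, 3 * c 1] := by
  simp only [us, Finset.sum_range_succ, Finset.sum_range_zero, wv_zero, w2_1, w2_2]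
  ext i j; fin_cases i <;> fin_cases j <;> simp [e0, mul_comm]

lemma us4 (c : ℕ → ℂ) : us v4 4 c =
    !![12 * c 2, -12 * c 1, 12 * c 0, 0; 24 * c 3, -12 * c 2, 0, 12 * c 0;
    24 * c 4, 0, -12 * c 2, 12 * c 1; 0, 24 * c 4, -24 * c 3, 12 * c 2] := by
  simp only [us, Finset.sum_range_succ, Finset.sum_range_zero, wv_zero, w4_1, w4_2, w4_3, w4_4]
  ext i j; fin_cases i <;> fin_cases j <;> simp [v4, mul_comm]

lemma us6 (c : ℕ → ℂ) : us v6 6 c =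
    !![-36 * c 3, 36 * c 2, -36 * c 1, 36 * c 0;
    -144 * c 4, 108 * c 3, -72 * c 2, 36 * c 1;
    -360 * c 5, 216 * c 4, -108 * c 3, 36 * c 2;
    -720 * c 6, 360 * c 5, -144 * c 4, 36 * c 3] := by
  simp only [us, Finset.sum_range_succ, Finset.sum_range_zero, wv_zero, w6_1, w6_2, w6_3, w6_4,
    w6_5, w6_6]
  ext i j; fin_cases i <;> fin_cases j <;> simp [v6, mul_comm]

lemma decomp (X : M4) (hX : X.trace = 0) : ∃ c2 c4 c6 : ℕ → ℂ,
    X = us e0 2 c2 + us v4 4 c4 + us v6 6 c6 := by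
  refine ⟨fun k => match k with
    | 0 => (1/10) * X 0 1 + (1/10) * X 1 2 + (1/10) * X 2 3
    | 1 => (-3/20) * X 0 0 + (-1/20) * X 1 1 + (1/20) * X 2 2 + (3/20) * X 3 3
    | _ => (-3/20) * X 1 0 + (-1/5) * X 2 1 + (-3/20) * X 3 2,
    fun k => match k with
    | 0 => (1/24) * X 0 2 + (1/24) * X 1 3
    | 1 => (-1/24) * X 0 1 + (1/24) * X 2 3
    | 2 => (1/48) * X 0 0 + (-1/48) * X 1 1 + (-1/48) * X 2 2 + (1/48) * X 3 3
    | 3 => (1/48) * X 1 0 + (-1/48) * X 3 2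
    | _ => (1/48) * X 2 0 + (1/48) * X 3 1,
    fun k => match k with
    | 0 => (1/36) * X 0 3
    | 1 => (-1/72) * X 0 2 + (1/72) * X 1 3
    | 2 => (1/180) * X 0 1 + (-1/120) * X 1 2 + (1/180) * X 2 3
    | 3 => (-1/720) * X 0 0 + (1/240) * X 1 1 + (-1/240) * X 2 2 + (1/720) * X 3 3
    | 4 => (-1/720) * X 1 0 + (1/360) * X 2 1 + (-1/720) * X 3 2
    | 5 => (-1/720) * X 2 0 + (1/720) * X 3 1
    | _ => (-1/720) * X 3 0, ?_⟩
  rw [us2, us4, us6]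
  have ht : X 0 0 + X 1 1 + X 2 2 + X 3 3 = 0 := by
    rw [← hX, Matrix.trace, Fin.sum_univ_four]; rfl
  ext i j
  fin_cases i <;> fin_cases j <;> simp <;> first
    | linear_combination (0:ℂ) * ht
    | linear_combination (1/4:ℂ) * ht

/-- the symplectic matrix -/
def J0 : Matrix (Fin 4) (Fin 4) ℂ := !![0, 0, 0, 1; 0, 0, -1, 0; 0, 1, 0, 0; -1, 0, 0, 0]

lemma sp2 (c : ℕ → ℂ) : J0 * us e0 2 c + (us e0 2 c)ᵀ * J0 = 0 := by
  rw [us2]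
  ext i j; fin_cases i <;> fin_cases j <;> simp [J0, Matrix.mul_apply, Fin.sum_univ_four]

lemma sp6 (c : ℕ → ℂ) : J0 * us v6 6 c + (us v6 6 c)ᵀ * J0 = 0 := by
  rw [us6]
  ext i j; fin_cases i <;> fin_cases j <;> simp [J0, Matrix.mul_apply, Fin.sum_univ_four]

lemma sp4 (c : ℕ → ℂ) (h : J0 * us v4 4 c + (us v4 4 c)ᵀ * J0 = 0) : us v4 4 c = 0 := by
  have h1 : (us v4 4 c)ᵀ * J0 = J0 * us v4 4 c := by
    rw [us4]
    ext i j; fin_cases i <;> fin_cases j <;> simp [J0, Matrix.mul_apply, Fin.sum_univ_four]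
  rw [h1, ← two_smul ℂ] at h
  have h2 : J0 * us v4 4 c = 0 := (smul_eq_zero.1 h).resolve_left (by norm_num)
  have h3 : (-J0) * J0 = 1 := by
    ext i j; fin_cases i <;> fin_cases j <;> simp [J0, Matrix.mul_apply, Fin.sum_univ_four]
  calc us v4 4 c = (-J0) * (J0 * us v4 4 c) := by rw [← mul_assoc, h3, one_mul]
    _ = 0 := by rw [h2, mul_zero]

lemma SubAlg.split (G : SubAlg 𝔤) {c2 c4 c6 : ℕ → ℂ}
    (h : us e0 2 c2 + us v4 4 c4 + us v6 6 c6 ∈ 𝔤) : us v4 4 c4 ∈ 𝔤 ∧ us v6 6 c6 ∈ 𝔤 := by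
  have h1 := G.cas h
  have h2 := G.cas h1
  have rs : ∀ (r : ℝ) (X : M4), (r:ℂ) • X = r • X := fun r X => by ext i j; simp
  have g2 : ∀ c, Cas (us e0 2 c) = (4:ℝ) • us e0 2 c := fun c => by
    rw [Cas_us hw2, ← rs]; norm_num
  have g4 : ∀ c, Cas (us v4 4 c) = (12:ℝ) • us v4 4 c := fun c => by
    rw [Cas_us hw4, ← rs]; norm_num
  have g6 : ∀ c, Cas (us v6 6 c) = (24:ℝ) • us v6 6 c := fun c => by
    rw [Cas_us hw6, ← rs]; norm_num
  have cs : ∀ (r : ℝ) (X : M4), Cas (r • X) = r • Cas X := fun r X => by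
    rw [← rs, map_smul, rs]
  simp only [map_add, g2, g4, g6, cs] at h1 h2
  constructor
  · have := 𝔤.add_mem (𝔤.add_mem (𝔤.smul_mem (-1/96:ℝ) h2) (𝔤.smul_mem (28/96:ℝ) h1))
      (𝔤.smul_mem (-1:ℝ) h)
    convert this using 1
    module
  · have := 𝔤.add_mem (𝔤.add_mem (𝔤.smul_mem (1/240:ℝ) h2) (𝔤.smul_mem (-16/240:ℝ) h1))
      (𝔤.smul_mem (48/240:ℝ) h)
    convert this using 1
    module

lemma us2_std (c : ℕ → ℂ) : us e0 2 c = (-c 1) • h0 + (c 0) • e0 + (-2 * c 2) • f0 := by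
  rw [us2]
  ext i j; fin_cases i <;> fin_cases j <;> simp [h0, e0, f0, mul_comm]

theorem SubAlg.classify (G : SubAlg 𝔤) :
    (∀ X ∈ 𝔤, ∃ a b c : ℂ, X = a • h0 + b • e0 + c • f0) ∨
    (∀ X : M4, X.trace = 0 → X ∈ 𝔤) ∨
    (∀ X : M4, X ∈ 𝔤 ↔ J0 * X + Xᵀ * J0 = 0) := by
  have m2 : ∀ c, us e0 2 c ∈ 𝔤 := fun c => by rw [us2_std]; exact G.std _ _ _
  by_cases h4 : ∀ c, us v4 4 c ∈ 𝔤
  · right; left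
    have m6 : ∀ c, us v6 6 c ∈ 𝔤 := by
      have a := h4 (fun k => if k = 0 then 1 else 0)
      have b := h4 (fun k => if k = 1 then 1 else 0)
      have ab := G.br _ a _ b
      refine G.all_of_hw hw6 (z := 8) (by norm_num) ?_
      convert ab using 1
      rw [us4, us4, wv_zero]
      ext i j
      fin_cases i <;> fin_cases j <;> simp [v6, Matrix.mul_apply, Fin.sum_univ_four]
      norm_num
    intro X hX
    obtain ⟨c2, c4, c6, rfl⟩ := decomp X hX
    exact 𝔤.add_mem (𝔤.add_mem (m2 _) (h4 _)) (m6 _)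
  · have z4 : ∀ c, us v4 4 c ∈ 𝔤 → us v4 4 c = 0 := fun c hc => (G.dichotomy hw4 hc).resolve_right h4
    by_cases h6 : ∀ c, us v6 6 c ∈ 𝔤
    · right; right
      intro X
      constructor
      · intro hX
        obtain ⟨c2, c4, c6, rfl⟩ := decomp X (G.tr X hX)
        rw [z4 c4 (G.split hX).1, add_zero, mul_add, Matrix.transpose_add, add_mul]
        calc _ = (J0 * us e0 2 c2 + (us e0 2 c2)ᵀ * J0) + (J0 * us v6 6 c6 + (us v6 6 c6)ᵀ * J0) := by
              abel
          _ = 0 := by rw [sp2, sp6, add_zero]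
      · intro hX
        have htr : X.trace = 0 := by
          have q := fun i j => congrFun (congrFun hX i) j
          have q1 := q 0 3
          have q2 := q 1 2
          simp [J0, Matrix.mul_apply, Matrix.vecMul, dotProduct, Fin.sum_univ_four] at q1 q2
          rw [Matrix.trace, Fin.sum_univ_four]
          simp only [Matrix.diag]
          linear_combination q1 - q2
        obtain ⟨c2, c4, c6, rfl⟩ := decomp X htr
        have : J0 * us v4 4 c4 + (us v4 4 c4)ᵀ * J0 = 0 := by
          rw [← hX]
          simp only [mul_add, Matrix.transpose_add, add_mul]
          calc J0 * us v4 4 c4 + (us v4 4 c4)ᵀ * J0 =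
              (J0 * us e0 2 c2 + (us e0 2 c2)ᵀ * J0) + (J0 * us v4 4 c4 + (us v4 4 c4)ᵀ * J0) +
              (J0 * us v6 6 c6 + (us v6 6 c6)ᵀ * J0) := by
                rw [sp2, sp6, add_zero, zero_add]
            _ = _ := by abel
        rw [sp4 c4 this, add_zero]
        exact 𝔤.add_mem (m2 _) (h6 _)
    · left
      intro X hX
      obtain ⟨c2, c4, c6, rfl⟩ := decomp X (G.tr X hX)
      obtain ⟨s4, s6⟩ := G.split hX
      rw [z4 c4 s4, (G.dichotomy hw6 s6).resolve_right h6, us2_std]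
      exact ⟨_, _, _, by rw [add_zero, add_zero]⟩

end Classify

end

section

section GroupPart

open Matrix

local notation "M4" => Matrix (Fin 4) (Fin 4) ℂ
local notation "V4" => Fin 4 → ℂ

/-- the symplectic form -/
def bf (x y : Fin 4 → ℂ) : ℂ := x 0 * y 3 - x 1 * y 2 + x 2 * y 1 - x 3 * y 0

/-- square zero element of the symplectic Lie algebra -/
def tx (a : ℂ) (u : Fin 4 → ℂ) : Matrix (Fin 4) (Fin 4) ℂ :=
  a • vecMulVec u ![-u 3, u 2, -u 1, u 0]

lemma tx_mulVec (a : ℂ) (u z : V4) : tx a u *ᵥ z = (a * bf u z) • u := by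
  ext i
  simp [tx, bf, Matrix.mulVec, dotProduct, Fin.sum_univ_four, vecMulVec_apply]
  ring

lemma bf_self (u : V4) : bf u u = 0 := by simp only [bf]; ring

lemma bf_add_left (x y z : V4) : bf (x + y) z = bf x z + bf y z := by
  simp only [bf, Pi.add_apply]; ring

lemma bf_add_right (x y z : V4) : bf x (y + z) = bf x y + bf x z := by
  simp only [bf, Pi.add_apply]; ring

lemma bf_sub_left (x y z : V4) : bf (x - y) z = bf x z - bf y z := by
  simp only [bf, Pi.sub_apply]; ring

lemma bf_smul_left (c : ℂ) (x z : V4) : bf (c • x) z = c * bf x z := by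
  simp only [bf, Pi.smul_apply, smul_eq_mul]; ring

lemma bf_smul_right (c : ℂ) (x z : V4) : bf x (c • z) = c * bf x z := by
  simp only [bf, Pi.smul_apply, smul_eq_mul]; ring

lemma bf_swap (x y : V4) : bf x y = - bf y x := by
  simp only [bf]; ring

lemma ext_mulVec {A B : M4} (h : ∀ z, A *ᵥ z = B *ᵥ z) : A = B :=
  Matrix.ext_of_mulVec_single fun i => h _

lemma tx_sq (a b : ℂ) (u : V4) : tx a u * tx b u = 0 := by
  apply ext_mulVec
  intro z
  rw [← mulVec_mulVec, tx_mulVec, tx_mulVec, bf_smul_right, bf_self, mul_zero, mul_zero, zero_smul,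
    zero_mulVec]

lemma tx_sp (a : ℂ) (u : V4) : J0 * tx a u + (tx a u)ᵀ * J0 = 0 := by
  have h : tx a u = Matrix.of fun i j => a * (u i * ![-u 3, u 2, -u 1, u 0] j) := by
    ext i j
    rw [tx, Matrix.smul_apply, vecMulVec_apply, smul_eq_mul, Matrix.of_apply]
  have hJ : ∀ Y : M4, ∀ i j, (J0 * Y + Yᵀ * J0) i j = (J0 i 0 * Y 0 j + J0 i 1 * Y 1 j +
      J0 i 2 * Y 2 j + J0 i 3 * Y 3 j) + (Y 0 i * J0 0 j + Y 1 i * J0 1 j + Y 2 i * J0 2 j +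
      Y 3 i * J0 3 j) := by
    intro Y i j
    rw [Matrix.add_apply, Matrix.mul_apply, Matrix.mul_apply, Fin.sum_univ_four, Fin.sum_univ_four]
    rfl
  ext i j
  rw [hJ, h]
  simp only [Matrix.of_apply]
  fin_cases i <;> fin_cases j <;> simp [J0] <;> ring

/-- transvection -/
def tv (a : ℂ) (u : Fin 4 → ℂ) : Matrix (Fin 4) (Fin 4) ℂ := 1 + tx a u

lemma tv_mulVec (a : ℂ) (u z : V4) : tv a u *ᵥ z = z + (a * bf u z) • u := by
  rw [tv, add_mulVec, one_mulVec, tx_mulVec]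

lemma tv_inv (a : ℂ) (u : V4) : tv (-a) u * tv a u = 1 := by
  have : tx (-a) u = - tx a u := by simp [tx]
  rw [tv, tv, this, mul_add, add_mul, add_mul, neg_mul, neg_mul, tx_sq]
  simp

/-- form preserving -/
def Pres (A : Matrix (Fin 4) (Fin 4) ℂ) : Prop := ∀ x y, bf (A *ᵥ x) (A *ᵥ y) = bf x y

lemma pres_mul {A B : M4} (hA : Pres A) (hB : Pres B) : Pres (A * B) := by
  intro x y
  rw [← mulVec_mulVec, ← mulVec_mulVec, hA, hB]

lemma pres_tv (a : ℂ) (u : V4) : Pres (tv a u) := by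
  intro x y
  rw [tv_mulVec, tv_mulVec]
  simp only [bf_add_left, bf_add_right, bf_smul_left, bf_smul_right, bf_self]
  rw [bf_swap x u]; ring

/-- moves that can be undone inside `S` -/
def Good (S : Submonoid (Matrix (Fin 4) (Fin 4) ℂ)) (W : Submodule ℂ (Fin 4 → ℂ))
    (g : Matrix (Fin 4) (Fin 4) ℂ) : Prop :=
  Pres g ∧ (∀ A, g * A ∈ S → A ∈ S) ∧ ∀ z, (∀ u ∈ W, bf u z = 0) → g *ᵥ z = z

variable {S : Submonoid (Matrix (Fin 4) (Fin 4) ℂ)} {W : Submodule ℂ (Fin 4 → ℂ)}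

lemma good_mul {g h : M4} (hg : Good S W g) (hh : Good S W h) : Good S W (g * h) := by
  refine ⟨pres_mul hg.1 hh.1, fun A hA => hh.2.1 _ (hg.2.1 _ (by rwa [← mul_assoc])), ?_⟩
  intro z hz
  rw [← mulVec_mulVec, hh.2.2 z hz, hg.2.2 z hz]

lemma good_tv (hS : ∀ a u, tv a u ∈ S) (a : ℂ) {u : V4} (hu : u ∈ W) : Good S W (tv a u) := by
  refine ⟨pres_tv a u, fun A hA => ?_, fun z hz => ?_⟩
  · have := S.mul_mem (hS (-a) u) hA
    rwa [← mul_assoc, tv_inv, one_mul] at this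
  · rw [tv_mulVec, hz u hu, mul_zero, zero_smul, add_zero]

lemma move1 (hS : ∀ a u, tv a u ∈ S) {x y : V4} (hx : x ∈ W) (hy : y ∈ W) (h : bf x y ≠ 0) :
    ∃ g, Good S W g ∧ g *ᵥ x = y ∧ ∀ z, bf (y - x) z = 0 → g *ᵥ z = z := by
  refine ⟨tv (1 / bf y x) (y - x), good_tv hS _ (W.sub_mem hy hx), ?_, ?_⟩
  · have h' : bf y x ≠ 0 := by rw [bf_swap]; exact neg_ne_zero.2 h
    rw [tv_mulVec, bf_sub_left, bf_self, sub_zero, one_div_mul_cancel h', one_smul]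
    abel
  · intro z hz
    rw [tv_mulVec, hz, mul_zero, zero_smul, add_zero]

lemma move (hS : ∀ a u, tv a u ∈ S) (hW : ∀ x ∈ W, x ≠ 0 → ∃ z ∈ W, bf x z ≠ 0) {x y : V4}
    (hx : x ∈ W) (hy : y ∈ W) (hx0 : x ≠ 0) (hy0 : y ≠ 0) :
    ∃ g, Good S W g ∧ g *ᵥ x = y := by
  obtain ⟨z, hz, h1, h2⟩ : ∃ z ∈ W, bf x z ≠ 0 ∧ bf z y ≠ 0 := by
    obtain ⟨p, hp, hp'⟩ := hW x hx hx0
    obtain ⟨q, hq, hq'⟩ := hW y hy hy0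
    rw [bf_swap, neg_ne_zero] at hq'
    by_cases h1 : bf p y = 0
    · by_cases h2 : bf x q = 0
      · refine ⟨p + q, W.add_mem hp hq, ?_, ?_⟩
        · rwa [bf_add_right, h2, add_zero]
        · rwa [bf_add_left, h1, zero_add]
      · exact ⟨q, hq, h2, hq'⟩
    · exact ⟨p, hp, hp', h1⟩
  obtain ⟨g, hg, hgx, -⟩ := move1 hS hx hz h1
  obtain ⟨k, hk, hkx, -⟩ := move1 hS hz hy h2
  exact ⟨k * g, good_mul hk hg, by rw [← mulVec_mulVec, hgx, hkx]⟩

lemma move2 (hS : ∀ a u, tv a u ∈ S) {e f f' : V4} (he : e ∈ W) (hf : f ∈ W) (hf' : f' ∈ W)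
    (h0 : bf e f ≠ 0) (hff : bf e f = bf e f') :
    ∃ g, Good S W g ∧ g *ᵥ f = f' ∧ g *ᵥ e = e := by
  by_cases h : bf f f' = 0
  · have h1 : bf f (f + e) ≠ 0 := by
      rw [bf_add_right, bf_self, zero_add, bf_swap]; exact neg_ne_zero.2 h0
    have h2 : bf (f + e) f' ≠ 0 := by
      rw [bf_add_left, h, zero_add, ← hff]; exact h0
    obtain ⟨g, hg, hgx, hge⟩ := move1 hS hf (W.add_mem hf he) h1
    obtain ⟨k, hk, hkx, hke⟩ := move1 hS (W.add_mem hf he) hf' h2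
    refine ⟨k * g, good_mul hk hg, by rw [← mulVec_mulVec, hgx, hkx], ?_⟩
    rw [← mulVec_mulVec, hge, hke]
    · rw [bf_sub_left, bf_add_left, bf_self, bf_swap f', bf_swap f, hff]; ring
    · rw [bf_sub_left, bf_add_left, bf_self]; ring
  · obtain ⟨g, hg, hgx, hge⟩ := move1 hS hf hf' h
    refine ⟨g, hg, hgx, hge _ ?_⟩
    rw [bf_sub_left, bf_swap f', bf_swap f, hff]; ring

lemma bf_nondeg {x : V4} (hx : ∀ z, bf x z = 0) : x = 0 := by
  have h0 := hx ![1, 0, 0, 0]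
  have h1 := hx ![0, 1, 0, 0]
  have h2 := hx ![0, 0, 1, 0]
  have h3 := hx ![0, 0, 0, 1]
  simp [bf] at h0 h1 h2 h3
  ext i; fin_cases i <;> simp [h0, h1, h2, h3]

/-- the middle plane -/
def midW : Submodule ℂ (Fin 4 → ℂ) where
  carrier := {x | x 0 = 0 ∧ x 3 = 0}
  add_mem' := by rintro a b ⟨h1, h2⟩ ⟨h3, h4⟩; simp [h1, h2, h3, h4]
  zero_mem' := by simp
  smul_mem' := by rintro c a ⟨h1, h2⟩; simp [h1, h2]

lemma mem_midW {x : V4} : x ∈ midW ↔ x 0 = 0 ∧ x 3 = 0 := Iff.rfl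

theorem pres_mem (hS : ∀ a u, tv a u ∈ S) (A : M4) (hA : Pres A) : A ∈ S := by
  -- step 1
  suffices h1 : ∀ A, Pres A → A *ᵥ ![1, 0, 0, 0] = ![1, 0, 0, 0] → A ∈ S by
    have b0 : (![1, 0, 0, 0] : V4) ≠ 0 := fun h => by simpa using congrFun h 0
    have hne : A *ᵥ ![1, 0, 0, 0] ≠ 0 := by
      intro h
      have := hA ![1, 0, 0, 0] ![0, 0, 0, 1]
      rw [h] at this
      simp [bf] at this
    obtain ⟨g, hg, hgx⟩ := move (W := ⊤) hS (fun x _ hx => by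
      by_contra hcon
      push Not at hcon
      exact hx (bf_nondeg fun z => hcon z trivial)) trivial trivial hne b0
    exact hg.2.1 _ (h1 _ (pres_mul hg.1 hA) (by rw [← mulVec_mulVec, hgx]))
  clear hA A
  -- step 2
  suffices h1 : ∀ A, Pres A → A *ᵥ ![1, 0, 0, 0] = ![1, 0, 0, 0] →
      A *ᵥ ![0, 0, 0, 1] = ![0, 0, 0, 1] → A ∈ S by
    intro A hA hA0
    have hB := hA ![1, 0, 0, 0] ![0, 0, 0, 1]
    rw [hA0] at hB
    obtain ⟨g, hg, hgx, hge⟩ := move2 (W := ⊤) hS (e := ![1, 0, 0, 0])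
      (f := A *ᵥ ![0, 0, 0, 1]) (f' := ![0, 0, 0, 1]) trivial trivial trivial
      (by rw [hB]; simp [bf]) hB
    exact hg.2.1 _ (h1 _ (pres_mul hg.1 hA) (by rw [← mulVec_mulVec, hA0, hge])
      (by rw [← mulVec_mulVec, hgx]))
  have hmid : ∀ A, Pres A → A *ᵥ ![1, 0, 0, 0] = ![1, 0, 0, 0] →
      A *ᵥ ![0, 0, 0, 1] = ![0, 0, 0, 1] → ∀ x ∈ midW, A *ᵥ x ∈ midW := by
    intro A hA h0 h3 x hx
    have q0 := hA ![1, 0, 0, 0] x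
    have q3 := hA ![0, 0, 0, 1] x
    rw [h0] at q0
    rw [h3] at q3
    obtain ⟨x0, x3⟩ := mem_midW.1 hx
    simp only [bf] at q0 q3
    simp [x0, x3] at q0 q3
    exact ⟨q3, q0⟩
  have hfix0 : ∀ u ∈ midW, bf u ![1, 0, 0, 0] = 0 := by
    rintro u ⟨u0, u3⟩; simp [bf, u3]
  have hfix3 : ∀ u ∈ midW, bf u ![0, 0, 0, 1] = 0 := by
    rintro u ⟨u0, u3⟩; simp [bf, u0]
  -- step 3
  suffices h1 : ∀ A, Pres A → A *ᵥ ![1, 0, 0, 0] = ![1, 0, 0, 0] →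
      A *ᵥ ![0, 0, 0, 1] = ![0, 0, 0, 1] → A *ᵥ ![0, 1, 0, 0] = ![0, 1, 0, 0] → A ∈ S by
    intro A hA hA0 hA3
    have b0 : (![0, 1, 0, 0] : V4) ≠ 0 := fun h => by simpa using congrFun h 1
    have hne : A *ᵥ ![0, 1, 0, 0] ≠ 0 := by
      intro h
      have := hA ![0, 1, 0, 0] ![0, 0, 1, 0]
      rw [h] at this
      simp [bf] at this
    obtain ⟨g, hg, hgx⟩ := move (W := midW) hS (fun x hxW hx => by
      by_contra hcon
      push Not at hcon
      obtain ⟨x0, x3⟩ := mem_midW.1 hxW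
      have q1 := hcon ![0, 1, 0, 0] (by simp [mem_midW])
      have q2 := hcon ![0, 0, 1, 0] (by simp [mem_midW])
      simp [bf] at q1 q2
      apply hx
      ext i; fin_cases i <;> simp [x0, x3, q1, q2]) (hmid A hA hA0 hA3 _ (by simp [mem_midW]))
      (by simp [mem_midW]) hne b0
    exact hg.2.1 _ (h1 _ (pres_mul hg.1 hA) (by rw [← mulVec_mulVec, hA0, hg.2.2 _ hfix0])
      (by rw [← mulVec_mulVec, hA3, hg.2.2 _ hfix3]) (by rw [← mulVec_mulVec, hgx]))
  -- step 4
  intro A hA hA0 hA3 hA1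
  have hB := hA ![0, 1, 0, 0] ![0, 0, 1, 0]
  rw [hA1] at hB
  obtain ⟨g, hg, hgx, hge⟩ := move2 (W := midW) hS (e := ![0, 1, 0, 0])
      (f := A *ᵥ ![0, 0, 1, 0]) (f' := ![0, 0, 1, 0]) (by simp [mem_midW])
      (hmid A hA hA0 hA3 _ (by simp [mem_midW])) (by simp [mem_midW])
      (by rw [hB]; simp [bf]) hB
  refine hg.2.1 _ ?_
  convert S.one_mem
  apply Matrix.ext_of_mulVec_single
  intro i
  rw [← mulVec_mulVec, one_mulVec]
  have s0 : (Pi.single 0 1 : V4) = ![1, 0, 0, 0] := by ext i; fin_cases i <;> simp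
  have s1 : (Pi.single 1 1 : V4) = ![0, 1, 0, 0] := by ext i; fin_cases i <;> simp
  have s2 : (Pi.single 2 1 : V4) = ![0, 0, 1, 0] := by ext i; fin_cases i <;> simp
  have s3 : (Pi.single 3 1 : V4) = ![0, 0, 0, 1] := by ext i; fin_cases i <;> simp
  fin_cases i
  · simp only [Fin.zero_eta, s0]; rw [hA0, hg.2.2 _ hfix0]
  · simp only [Fin.mk_one, s1]; rw [hA1, hge]
  · simp only [Fin.reduceFinMk, s2]; rw [hgx]
  · simp only [Fin.reduceFinMk, s3]; rw [hA3, hg.2.2 _ hfix3]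

lemma bf_eq (x y : V4) : bf x y = x ⬝ᵥ (J0 *ᵥ y) := by
  simp [bf, J0, dotProduct, Fin.sum_univ_four, Matrix.mulVec]; ring

lemma pres_mexp (X : M4) (hX : J0 * X + Xᵀ * J0 = 0) : Pres (mexp X) := by
  have h3 : (-J0) * J0 = 1 := by
    ext i j; fin_cases i <;> fin_cases j <;> simp [J0, Matrix.mul_apply, Fin.sum_univ_four]
  have h3' : J0 * (-J0) = 1 := by rw [mul_neg, ← neg_mul, h3]
  have h4 : Xᵀ = J0 * (-X) * (-J0) := by
    have : Xᵀ * J0 = J0 * (-X) := by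
      rw [mul_neg]; exact eq_neg_of_add_eq_zero_right hX
    rw [← this, mul_assoc, h3', mul_one]
  have h5 : (mexp X)ᵀ * J0 * mexp X = J0 := by
    rw [← mexp_transpose, h4, mexp_conj h3' h3]
    calc J0 * mexp (-X) * (-J0) * J0 * mexp X = J0 * mexp (-X) * ((-J0) * J0) * mexp X := by
          simp only [mul_assoc]
      _ = J0 * (mexp (-X) * mexp X) := by rw [h3, mul_one, mul_assoc]
      _ = J0 := by rw [mexp_neg_mul, mul_one]
  intro x y
  rw [bf_eq, bf_eq, ← vecMul_transpose, ← dotProduct_mulVec, mulVec_mulVec, mulVec_mulVec, h5]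

theorem sl_mem (hS : ∀ X : M4, X.trace = 0 → mexp X ∈ S) (A : M4) (hA : A.det = 1) : A ∈ S := by
  apply diagonal_transvection_induction (· ∈ S) A
  · intro D hD
    rw [hA, det_diagonal, Fin.prod_univ_four] at hD
    have hne : ∀ i, D i ≠ 0 := by
      intro i h
      fin_cases i <;> simp at h <;> simp [h] at hD
    have h := hS (diagonal ![-(Complex.log (D 1) + Complex.log (D 2) + Complex.log (D 3)),
      Complex.log (D 1), Complex.log (D 2), Complex.log (D 3)]) (by
        rw [trace_diagonal, Fin.sum_univ_four]; simp; ring)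
    rw [mexp_diagonal] at h
    convert h using 1
    congr 1
    funext i
    fin_cases i
    · simp only [Fin.zero_eta, cons_val_zero, Complex.exp_neg, Complex.exp_add,
        Complex.exp_log (hne _)]
      refine eq_inv_of_mul_eq_one_left ?_
      linear_combination hD
    all_goals simp [Complex.exp_log (hne _)]
  · intro t
    have hsq : single t.i t.j t.c * single t.i t.j t.c = 0 :=
      single_mul_single_of_ne _ _ _ _ t.hij.symm _
    have := hS (single t.i t.j t.c) (trace_single_eq_of_ne _ _ _ t.hij)
    rwa [mexp_sq_zero _ hsq] at this
  · intro A B hA hB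
    exact S.mul_mem hA hB

end GroupPart

end

section

section FinalPart

open Matrix

local notation "M4" => Matrix (Fin 4) (Fin 4) ℂ

/-- conjugation as a real linear map -/
def cnj (P Q : Matrix (Fin 4) (Fin 4) ℂ) :
    Matrix (Fin 4) (Fin 4) ℂ →ₗ[ℝ] Matrix (Fin 4) (Fin 4) ℂ where
  toFun X := P * X * Q
  map_add' X Y := by rw [mul_add, add_mul]
  map_smul' r X := by simp

/-- conjugated submonoid -/
def cnjM {P Q : Matrix (Fin 4) (Fin 4) ℂ} (hPQ : P * Q = 1) (hQP : Q * P = 1)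
    (S : Submonoid (Matrix (Fin 4) (Fin 4) ℂ)) : Submonoid (Matrix (Fin 4) (Fin 4) ℂ) where
  carrier := {A | P * A * Q ∈ S}
  one_mem' := by
    change P * 1 * Q ∈ S
    rw [mul_one, hPQ]; exact S.one_mem
  mul_mem' := by
    intro A B hA hB
    have : P * (A * B) * Q = (P * A * Q) * (P * B * Q) := by
      calc P * (A * B) * Q = P * A * 1 * B * Q := by simp only [mul_one, mul_assoc]
        _ = _ := by rw [← hQP]; simp only [mul_assoc]
    change P * (A * B) * Q ∈ S
    rw [this]
    exact S.mul_mem hA hB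

lemma cnj_mul {P Q : M4} (hQP : Q * P = 1) (A B : M4) :
    P * (A * B) * Q = (P * A * Q) * (P * B * Q) := by
  calc P * (A * B) * Q = P * A * 1 * B * Q := by simp only [mul_one, mul_assoc]
    _ = _ := by rw [← hQP]; simp only [mul_assoc]

lemma cnj_cancel {P Q : M4} (hPQ : P * Q = 1) (X : M4) : P * (Q * X * P) * Q = X := by
  calc P * (Q * X * P) * Q = (P * Q) * X * (P * Q) := by simp only [mul_assoc]
    _ = X := by rw [hPQ, one_mul, mul_one]

/-- the pulled back bilinear form -/
def bfQ (Q : Matrix (Fin 4) (Fin 4) ℂ) : (Fin 4 → ℂ) →ₗ[ℂ] (Fin 4 → ℂ) →ₗ[ℂ] ℂ :=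
  LinearMap.mk₂ ℂ (fun x y => bf (Q *ᵥ x) (Q *ᵥ y))
    (fun x y z => by rw [mulVec_add, bf_add_left])
    (fun c x z => by rw [mulVec_smul, bf_smul_left, smul_eq_mul])
    (fun x y z => by rw [mulVec_add, bf_add_right])
    (fun c x z => by rw [mulVec_smul, bf_smul_right, smul_eq_mul])

lemma bfQ_apply (Q : M4) (x y : Fin 4 → ℂ) : bfQ Q x y = bf (Q *ᵥ x) (Q *ᵥ y) := rfl

lemma pres_iff {P Q : M4} (hPQ : P * Q = 1) (hQP : Q * P = 1) (A : M4) :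
    Pres (Q * A * P) ↔ ∀ x y, bfQ Q (A *ᵥ x) (A *ᵥ y) = bfQ Q x y := by
  have h : ∀ x, (Q * A * P) *ᵥ (Q *ᵥ x) = Q *ᵥ (A *ᵥ x) := by
    intro x
    rw [mulVec_mulVec, mulVec_mulVec, mul_assoc, mul_assoc, hPQ, mul_one]
  have h' : ∀ x, Q *ᵥ (P *ᵥ x) = x := by
    intro x
    rw [mulVec_mulVec, hQP, one_mulVec]
  constructor
  · intro hA x y
    rw [bfQ_apply, bfQ_apply, ← h, ← h, hA]
  · intro hA x y
    have := hA (P *ᵥ x) (P *ᵥ y)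
    rwa [bfQ_apply, bfQ_apply, ← h, ← h, h', h'] at this

theorem final_aux
    (ρ : Matrix.SpecialLinearGroup (Fin 2) ℂ →* Matrix.SpecialLinearGroup (Fin 4) ℂ)
    (hρcont : Continuous ρ) (hρinj : Function.Injective ρ)
    (hirr : ∀ W : Submodule ℂ (Fin 4 → ℂ),
      (∀ g : Matrix.SpecialLinearGroup (Fin 2) ℂ, ∀ w ∈ W,
        ((ρ g : Matrix (Fin 4) (Fin 4) ℂ)).mulVec w ∈ W) → W = ⊥ ∨ W = ⊤)
    (F : Subgroup (Matrix.SpecialLinearGroup (Fin 4) ℂ))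
    (hFc : IsClosed (F : Set (Matrix.SpecialLinearGroup (Fin 4) ℂ)))
    (hFconn : IsConnected (F : Set (Matrix.SpecialLinearGroup (Fin 4) ℂ)))
    (hρF : ρ.range ≤ F) :
    F = ρ.range ∨ F = ⊤ ∨
      ∃ B : (Fin 4 → ℂ) →ₗ[ℂ] (Fin 4 → ℂ) →ₗ[ℂ] ℂ, B ≠ 0 ∧ (∀ x, B x x = 0) ∧
        (∀ g : Matrix.SpecialLinearGroup (Fin 2) ℂ, ∀ x y,
          B ((ρ g : Matrix (Fin 4) (Fin 4) ℂ).mulVec x)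
            ((ρ g : Matrix (Fin 4) (Fin 4) ℂ).mulVec y) = B x y) ∧
        (F : Set (Matrix.SpecialLinearGroup (Fin 4) ℂ)) =
          {g : Matrix.SpecialLinearGroup (Fin 4) ℂ |
            ∀ x y, B ((g : Matrix (Fin 4) (Fin 4) ℂ).mulVec x)
              ((g : Matrix (Fin 4) (Fin 4) ℂ).mulVec y) = B x y} := by
  obtain ⟨P, Q, hPQ, hQP, hstd⟩ := exists_std ρ hρcont hρinj hirr
  obtain ⟨𝔤, hg, hbr, htr, hexp, hgen⟩ := exists_lie F hFc hFconn
  have hmono : ∀ A, A ∈ subM ρ.range → A ∈ subM F := by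
    intro A hA
    obtain ⟨g, hgr, rfl⟩ := mem_subM.1 hA
    exact coe_mem_subM.2 (hρF hgr)
  have hmem' : ∀ X, X ∈ 𝔤.comap (cnj P Q) ↔ P * X * Q ∈ 𝔤 := fun X => Iff.rfl
  have G : SubAlg (𝔤.comap (cnj P Q)) := by
    refine ⟨fun X hX Y hY => ?_, fun a b c => ?_, fun X hX => ?_⟩
    · have := hbr _ hX _ hY
      rw [hmem', mul_sub, sub_mul, cnj_mul hQP, cnj_mul hQP]
      exact this
    · rw [hmem', hg]
      intro t
      have := hmono _ (hstd (t * a) (t * b) (t * c))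
      convert this using 2
      rw [← smul_mul_assoc, ← mul_smul_comm]
      congr 2
      ext i j
      simp
      ring
    · have := htr _ hX
      change (P * X * Q).trace = 0 at this
      rwa [Matrix.trace_mul_comm, ← mul_assoc, hQP, one_mul] at this
  have hback : ∀ X ∈ 𝔤, Q * X * P ∈ 𝔤.comap (cnj P Q) := by
    intro X hX
    rw [hmem', cnj_cancel hPQ]; exact hX
  rcases G.classify with h | h | h
  · left
    refine le_antisymm ?_ hρF
    have := hgen (subM ρ.range) (fun X hX => by
      obtain ⟨a, b, c, habc⟩ := h _ (hback X hX)
      have := hstd a b c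
      rwa [← habc, cnj_cancel hPQ] at this)
    intro g hgF
    exact coe_mem_subM.1 (this (coe_mem_subM.2 hgF))
  · right; left
    rw [eq_top_iff]
    intro g _
    refine coe_mem_subM.1 (sl_mem (S := subM F) (fun X hX => hexp _ ?_) _ g.2)
    have := h (Q * X * P) (by rw [Matrix.trace_mul_comm, ← mul_assoc, hPQ, one_mul, hX])
    rwa [hmem', cnj_cancel hPQ] at this
  · right; right
    have key : ∀ g : Matrix.SpecialLinearGroup (Fin 4) ℂ, g ∈ F ↔ ∀ x y,
        bfQ Q ((g : Matrix (Fin 4) (Fin 4) ℂ) *ᵥ x) ((g : Matrix (Fin 4) (Fin 4) ℂ) *ᵥ y) =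
          bfQ Q x y := by
      intro g
      constructor
      · intro hgF
        let T : Submonoid M4 :=
          { carrier := {A | ∀ x y, bfQ Q (A *ᵥ x) (A *ᵥ y) = bfQ Q x y}
            one_mem' := by intro x y; simp
            mul_mem' := by
              intro A B hA hB x y
              rw [← mulVec_mulVec, ← mulVec_mulVec, hA, hB] }
        have hT : subM F ≤ T := by
          refine hgen T fun X hX => ?_
          refine (pres_iff hPQ hQP _).1 ?_
          rw [← mexp_conj hQP hPQ]
          exact pres_mexp _ ((h _).1 (hback X hX))
        exact hT (coe_mem_subM.2 hgF)
      · intro hgp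
        have h1 := (pres_iff hPQ hQP _).2 hgp
        have h2 := pres_mem (S := cnjM hPQ hQP (subM F)) (fun a u => by
          change P * tv a u * Q ∈ subM F
          have := hexp _ ((hmem' _).1 ((h (tx a u)).2 (tx_sp a u)))
          rwa [mexp_conj hPQ hQP, mexp_sq_zero _ (tx_sq a a u)] at this) _ h1
        change P * (Q * g * P) * Q ∈ subM F at h2
        rw [cnj_cancel hPQ] at h2
        exact coe_mem_subM.1 h2
    refine ⟨bfQ Q, ?_, fun x => bf_self _, fun g => (key (ρ g)).1 (hρF ⟨g, rfl⟩), ?_⟩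
    · intro h0
      have := LinearMap.congr_fun (LinearMap.congr_fun h0 (P *ᵥ ![1, 0, 0, 0]))
        (P *ᵥ ![0, 0, 0, 1])
      rw [bfQ_apply, mulVec_mulVec, mulVec_mulVec, hQP, one_mulVec, one_mulVec] at this
      simp [bf] at this
    · ext g
      exact key g

end FinalPart

end

/-- Classification of intermediate groups: let `ρ : SL(2,ℂ) → SL(4,ℂ)` be an injective
continuous homomorphism acting irreducibly on `ℂ⁴` (i.e. the `Sym³` embedding, up to
conjugacy).  Every closed connected subgroup `F` with `ρ(SL(2,ℂ)) ⊆ F ⊆ SL(4,ℂ)` is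
`ρ(SL(2,ℂ))`, all of `SL(4,ℂ)`, or the symplectic group `Sp(4,ℂ)` of the (unique up to
scalar) `ρ(SL(2,ℂ))`-invariant nonzero alternating bilinear form `B`. -/
theorem closed_connected_subgroup_between_SL2_SL4
    (ρ : Matrix.SpecialLinearGroup (Fin 2) ℂ →* Matrix.SpecialLinearGroup (Fin 4) ℂ)
    (hρcont : Continuous ρ) (hρinj : Function.Injective ρ)
    (hirr : ∀ W : Submodule ℂ (Fin 4 → ℂ),
      (∀ g : Matrix.SpecialLinearGroup (Fin 2) ℂ, ∀ w ∈ W,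
        ((ρ g : Matrix (Fin 4) (Fin 4) ℂ)).mulVec w ∈ W) → W = ⊥ ∨ W = ⊤)
    (F : Subgroup (Matrix.SpecialLinearGroup (Fin 4) ℂ))
    (hFc : IsClosed (F : Set (Matrix.SpecialLinearGroup (Fin 4) ℂ)))
    (hFconn : IsConnected (F : Set (Matrix.SpecialLinearGroup (Fin 4) ℂ)))
    (hρF : ρ.range ≤ F) :
    F = ρ.range ∨ F = ⊤ ∨
      ∃ B : (Fin 4 → ℂ) →ₗ[ℂ] (Fin 4 → ℂ) →ₗ[ℂ] ℂ, B ≠ 0 ∧ (∀ x, B x x = 0) ∧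
        (∀ g : Matrix.SpecialLinearGroup (Fin 2) ℂ, ∀ x y,
          B ((ρ g : Matrix (Fin 4) (Fin 4) ℂ).mulVec x)
            ((ρ g : Matrix (Fin 4) (Fin 4) ℂ).mulVec y) = B x y) ∧
        (F : Set (Matrix.SpecialLinearGroup (Fin 4) ℂ)) =
          {g : Matrix.SpecialLinearGroup (Fin 4) ℂ |
            ∀ x y, B ((g : Matrix (Fin 4) (Fin 4) ℂ).mulVec x)
              ((g : Matrix (Fin 4) (Fin 4) ℂ).mulVec y) = B x y} := by
  exact final_aux ρ hρcont hρinj hirr F hFc hFconn hρF
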